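/- arXiv:2407.15744 — 6 statements merged into one kernel-verified Lean document; each statement's English description precedes it below -/
import Mathlib

section
/- Let G be a canonical directed mixed graph and {j}, {k}, L pairwise disjoint subsets of V with j, k single vertices. Then the following are equivalent: (i) some trek from j to k has no non-endpoint in L; (ii) some arc from j to k has no non-endpoint in L; (iii) some arc from j to k that is a path has no non-endpoint in L; (iv) some arc from j to k in trim(G) has no non-endpoint in L; (v) some arc from j to k in trim(G) that is a path has no non-endpoint in L. If moreover G is canonically directed and acyclic, these are also equivalent to: (vi) some d-connected walk from j to k in G has no non-endpoint in L; (vii) some d-connected path from j to k in G has no non-endpoint in L; (viii) some d-connected walk from j to k in trim(G) has no non-endpoint in L; (ix) some d-connected path from j to k in trim(G) has no non-endpoint in L. -/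
/-! ### Walks on directed mixed graphs -/

/-- How an edge is traversed by a walk. -/
inductive EKind : Type
  | fwd   -- a directed edge traversed forwards:  `a → b`
  | bwd   -- a directed edge traversed backwards: `a ← b` (the edge is `b → a`)
  | bidir -- a bidirected edge: `a ↔ b`
  deriving DecidableEq

/-- A directed mixed graph on vertex type `V` (directed edges `dir`, bidirected
edges `bi`; loops are allowed). -/
structure MixedGraph (V : Type*) where
  dir : V → V → Prop
  bi : V → V → Prop

/-- A candidate walk: a starting vertex together with a list of steps; each step
records how the next edge is traversed and the next vertex reached. -/
structure MWalk (V : Type*) where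
  head : V
  tail : List (EKind × V)

namespace MWalk

variable {V : Type*}

/-- The last vertex of a walk. -/
def last (w : MWalk V) : V := (w.tail.map Prod.snd).getLastD w.head

/-- The list of vertex occurrences of a walk. -/
def verts (w : MWalk V) : List V := w.head :: w.tail.map Prod.snd

/-- The length (number of edge-traversals) of a walk. -/
def length (w : MWalk V) : ℕ := w.tail.length

/-- The non-endpoint (interior) vertex occurrences of a walk. -/
def interior (w : MWalk V) : List V := (w.tail.map Prod.snd).dropLast

/-- Does this kind of traversal have an arrowhead at its end vertex? -/
def arrowAtEnd : EKind → Bool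
  | .fwd => true
  | .bwd => false
  | .bidir => true

/-- Does this kind of traversal have an arrowhead at its start vertex? -/
def arrowAtStart : EKind → Bool
  | .fwd => false
  | .bwd => true
  | .bidir => true

/-- The interior vertex occurrence reached by step `i` (present when
`i + 1 < w.tail.length`) is a collider. -/
def ColliderAt (w : MWalk V) (i : ℕ) : Prop :=
  ∃ s t : EKind × V, w.tail[i]? = some s ∧ w.tail[i + 1]? = some t ∧
    arrowAtEnd s.1 = true ∧ arrowAtStart t.1 = true

/-- The walk contains no collider. -/
def NoCollider (w : MWalk V) : Prop := ∀ i, ¬ w.ColliderAt i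

/-- Validity in `G` of a list of steps starting at a given vertex. -/
def Valid (G : MixedGraph V) : V → List (EKind × V) → Prop
  | _, [] => True
  | a, s :: rest =>
      (match s.1 with
        | EKind.fwd => G.dir a s.2
        | EKind.bwd => G.dir s.2 a
        | EKind.bidir => G.bi a s.2) ∧ Valid G s.2 rest

/-- `w` is a walk (with at least one edge) in `G`. -/
def IsWalk (G : MixedGraph V) (w : MWalk V) : Prop := w.tail ≠ [] ∧ Valid G w.head w.tail

/-- `w` is a walk in `G` from `j` to `k`. -/
def IsWalkFrom (G : MixedGraph V) (w : MWalk V) (j k : V) : Prop :=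
  IsWalk G w ∧ w.head = j ∧ w.last = k

/-- A right-directed walk: all directed edges traversed forwards. -/
def IsRightDirected (w : MWalk V) : Prop := ∀ s ∈ w.tail, s.1 = EKind.fwd

/-- A left-directed walk: all directed edges traversed backwards. -/
def IsLeftDirected (w : MWalk V) : Prop := ∀ s ∈ w.tail, s.1 = EKind.bwd

/-- A walk using only directed edges (traversed in either direction). -/
def DirectedOnly (w : MWalk V) : Prop := ∀ s ∈ w.tail, s.1 ≠ EKind.bidir

/-- A trek: a (possibly empty) left leg of directed edges traversed backwards,
then exactly one bidirected edge, then a (possibly empty) right leg of directed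
edges traversed forwards. -/
def IsTrek (w : MWalk V) : Prop :=
  ∃ (l : List (EKind × V)) (b : EKind × V) (r : List (EKind × V)),
    w.tail = l ++ b :: r ∧ (∀ s ∈ l, s.1 = EKind.bwd) ∧ b.1 = EKind.bidir ∧
      (∀ s ∈ r, s.1 = EKind.fwd)

/-- A d-connected walk: directed edges traversed backwards followed by directed
edges traversed forwards, at least one edge in total. -/
def IsDConnWalk (w : MWalk V) : Prop :=
  w.tail ≠ [] ∧ ∃ l r : List (EKind × V), w.tail = l ++ r ∧
    (∀ s ∈ l, s.1 = EKind.bwd) ∧ (∀ s ∈ r, s.1 = EKind.fwd)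

/-- An arc (m-connected walk): a trek or a d-connected walk. -/
def IsArc (w : MWalk V) : Prop := IsTrek w ∨ IsDConnWalk w

/-- A path: a walk visiting no vertex more than once. -/
def IsPath (w : MWalk V) : Prop := w.verts.Nodup

/-- The number of bidirected edges traversed by the walk. -/
def bidirCount (w : MWalk V) : ℕ := w.tail.countP (fun s => decide (s.1 = EKind.bidir))

/-- `w` is blocked by `L`: some collider on it lies outside `L`, or some
non-collider non-endpoint on it lies in `L`. -/
def Blocked (w : MWalk V) (L : Set V) : Prop :=
  ∃ (i : ℕ) (v : V), i + 1 < w.tail.length ∧ (w.tail[i]?).map Prod.snd = some v ∧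
    ((w.ColliderAt i ∧ v ∉ L) ∨ (¬ w.ColliderAt i ∧ v ∈ L))

/-- A collider-connected walk: all non-endpoints are colliders. -/
def IsColliderConnected (w : MWalk V) : Prop := ∀ i, i + 1 < w.tail.length → w.ColliderAt i

/-- The weight of a list of steps starting from a given vertex: `β l m` for a
traversal (in either direction) of the directed edge `l → m` and `Λ l m` for a
traversal of the bidirected edge `l ↔ m`. -/
def weightFrom (β Λ : V → V → ℝ) : V → List (EKind × V) → ℝ
  | _, [] => 1
  | a, s :: rest =>
      (match s.1 with
        | EKind.fwd => β a s.2
        | EKind.bwd => β s.2 a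
        | EKind.bidir => Λ a s.2) * weightFrom β Λ s.2 rest

/-- The weight of a walk. -/
def weight (β Λ : V → V → ℝ) (w : MWalk V) : ℝ := weightFrom β Λ w.head w.tail

end MWalk

namespace MixedGraph

variable {V : Type*}

/-- The bidirected edge relation is symmetric. -/
def BiSymm (G : MixedGraph V) : Prop := ∀ j k, G.bi j k → G.bi k j

/-- Canonical: every vertex carries a bidirected loop. -/
def Canonical (G : MixedGraph V) : Prop := ∀ v, G.bi v v

/-- Canonically directed: the bidirected edges are exactly the loops. -/
def CanonicallyDirected (G : MixedGraph V) : Prop := ∀ j k, G.bi j k ↔ j = k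

/-- There is a right-directed walk from `j` to `k` in `G`. -/
def RDConn (G : MixedGraph V) (j k : V) : Prop :=
  ∃ w : MWalk V, MWalk.IsWalkFrom G w j k ∧ w.IsRightDirected

/-- Acyclicity: no right-directed walk from a vertex to itself. -/
def Acyclic (G : MixedGraph V) : Prop := ∀ v, ¬ G.RDConn v v

/-- Remove all bidirected loops. -/
def trim (G : MixedGraph V) : MixedGraph V where
  dir := G.dir
  bi j k := G.bi j k ∧ j ≠ k

/-- m-connection given `L`: some walk from `j` to `k` is not blocked by `L`. -/
def MConn (G : MixedGraph V) (j k : V) (L : Set V) : Prop :=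
  ∃ w : MWalk V, MWalk.IsWalkFrom G w j k ∧ ¬ w.Blocked L

/-- d-connection given `L`: some walk from `j` to `k` using only directed edges
is not blocked by `L`. -/
def DConn (G : MixedGraph V) (j k : V) (L : Set V) : Prop :=
  ∃ w : MWalk V, MWalk.IsWalkFrom G w j k ∧ w.DirectedOnly ∧ ¬ w.Blocked L

/-- `w` is ancestrally blocked by `L`: it contains a collider `v ∉ L` with no
right-directed walk from `v` to a member of `L`, or a non-collider non-endpoint
in `L`. -/
def AncBlocked (G : MixedGraph V) (w : MWalk V) (L : Set V) : Prop :=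
  ∃ (i : ℕ) (v : V), i + 1 < w.tail.length ∧ (w.tail[i]?).map Prod.snd = some v ∧
    ((w.ColliderAt i ∧ v ∉ L ∧ ¬ ∃ l ∈ L, G.RDConn v l) ∨ (¬ w.ColliderAt i ∧ v ∈ L))

/-- The marginal graph (latent projection) of `G` on `T`. -/
def marg (G : MixedGraph V) (T : Set V) : MixedGraph V where
  dir j k := j ∈ T ∧ k ∈ T ∧ ∃ w : MWalk V, MWalk.IsWalkFrom G w j k ∧
      w.IsRightDirected ∧ ∀ v ∈ w.interior, v ∉ T
  bi j k := j ∈ T ∧ k ∈ T ∧ ∃ w : MWalk V, MWalk.IsWalkFrom G w j k ∧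
      w.IsTrek ∧ ∀ v ∈ w.interior, v ∉ T

/-- t-connection given `L`: a concatenation of treks, each not blocked by `L`,
with consecutive treks meeting at vertices belonging to `L`. -/
inductive TConn (G : MixedGraph V) (L : Set V) : V → V → Prop
  | single {j k : V} (w : MWalk V) (hw : MWalk.IsWalkFrom G w j k) (ht : w.IsTrek)
      (hb : ¬ w.Blocked L) : TConn G L j k
  | cons {j m k : V} (w : MWalk V) (hw : MWalk.IsWalkFrom G w j m) (ht : w.IsTrek)
      (hb : ¬ w.Blocked L) (hm : m ∈ L) (h : TConn G L m k) : TConn G L j k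

end MixedGraph

namespace TrekAux

open MWalk

variable {V : Type*}

def lastv : V → List (EKind × V) → V
  | a, [] => a
  | _, s :: t => lastv s.2 t

theorem last_eq (a : V) (t : List (EKind × V)) : MWalk.last ⟨a, t⟩ = lastv a t := by
  induction t generalizing a with
  | nil => rfl
  | cons s t ih =>
    rw [lastv, ← ih s.2]
    simp only [MWalk.last, List.map_cons, List.getLastD_cons]

theorem lastv_append (a : V) (l r : List (EKind × V)) :
    lastv a (l ++ r) = lastv (lastv a l) r := by
  induction l generalizing a with
  | nil => rfl
  | cons s t ih => exact ih s.2

theorem valid_append (G : MixedGraph V) (a : V) (l r : List (EKind × V)) :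
    Valid G a (l ++ r) ↔ Valid G a l ∧ Valid G (lastv a l) r := by
  induction l generalizing a with
  | nil => simp [Valid, lastv]
  | cons s t ih => simp only [List.cons_append, Valid, lastv, ih, and_assoc]

theorem lastv_mem (a : V) (t : List (EKind × V)) : lastv a t ∈ a :: t.map Prod.snd := by
  induction t generalizing a with
  | nil => simp [lastv]
  | cons s t ih =>
    rw [lastv, List.map_cons]
    exact List.mem_cons_of_mem _ (ih s.2)

theorem interior_iff {j k : V} {L : Set V} (hk : k ∉ L) (t : List (EKind × V))
    (hl : lastv j t = k) :
    (∀ v ∈ MWalk.interior ⟨j, t⟩, v ∉ L) ↔ ∀ s ∈ t, s.2 ∉ L := by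
  rcases List.eq_nil_or_concat t with rfl | ⟨t, s, rfl⟩
  · simp [MWalk.interior]
  · rw [List.concat_eq_append] at *
    rw [lastv_append] at hl
    simp only [lastv] at hl
    simp only [MWalk.interior, List.map_append, List.map_cons, List.map_nil,
      List.dropLast_concat, List.mem_map, List.mem_append, List.mem_singleton]
    constructor
    · rintro h x (hx | rfl)
      · exact h _ ⟨x, hx, rfl⟩
      · rwa [hl]
    · rintro h v ⟨x, hx, rfl⟩
      exact h x (Or.inl hx)

def R (a b : EKind × V) : Prop := a.1 = EKind.bwd ∨ b.1 = EKind.fwd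

theorem arc_pairwise {w : MWalk V} (h : w.IsArc) : w.tail.Pairwise R := by
  rcases h with ⟨l, b, r, e, h1, h2, h3⟩ | ⟨_, l, r, e, h1, h3⟩
  · rw [e, List.pairwise_append, List.pairwise_cons]
    refine ⟨List.pairwise_of_forall_mem_list ?_, ⟨?_, List.pairwise_of_forall_mem_list ?_⟩, ?_⟩
    · intro a ha _ _; exact Or.inl (h1 a ha)
    · intro a ha; exact Or.inr (h3 a ha)
    · intro _ _ a ha; exact Or.inr (h3 a ha)
    · intro a ha _ _; exact Or.inl (h1 a ha)
  · rw [e, List.pairwise_append]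
    refine ⟨List.pairwise_of_forall_mem_list ?_, List.pairwise_of_forall_mem_list ?_, ?_⟩
    · intro a ha _ _; exact Or.inl (h1 a ha)
    · intro _ _ a ha; exact Or.inr (h3 a ha)
    · intro a ha _ _; exact Or.inl (h1 a ha)

theorem pairwise_shape (t : List (EKind × V)) (h : t.Pairwise R) :
    (∃ (l : List (EKind × V)) (b : EKind × V) (r : List (EKind × V)),
      t = l ++ b :: r ∧ (∀ s ∈ l, s.1 = EKind.bwd) ∧ b.1 = EKind.bidir ∧
      (∀ s ∈ r, s.1 = EKind.fwd)) ∨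
    (∃ l r : List (EKind × V), t = l ++ r ∧
      (∀ s ∈ l, s.1 = EKind.bwd) ∧ (∀ s ∈ r, s.1 = EKind.fwd)) := by
  induction t with
  | nil => exact Or.inr ⟨[], [], rfl, by simp, by simp⟩
  | cons s t ih =>
    rw [List.pairwise_cons] at h
    obtain ⟨h1, h2⟩ := h
    cases hs : s.1 with
    | bwd =>
      rcases ih h2 with ⟨l, b, r, e, h3, h4, h5⟩ | ⟨l, r, e, h3, h5⟩
      · exact Or.inl ⟨s :: l, b, r, by rw [e]; rfl, by simpa [hs] using h3, h4, h5⟩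
      · exact Or.inr ⟨s :: l, r, by rw [e]; rfl, by simpa [hs] using h3, h5⟩
    | fwd =>
      refine Or.inr ⟨[], s :: t, rfl, by simp, ?_⟩
      intro x hx
      rcases List.mem_cons.1 hx with rfl | hx
      · exact hs
      · simpa [R, hs] using h1 x hx
    | bidir =>
      refine Or.inl ⟨[], s, t, rfl, by simp, hs, ?_⟩
      intro x hx
      simpa [R, hs] using h1 x hx

theorem shorten (G : MixedGraph V) (t : List (EKind × V)) (a : V) (h : Valid G a t) :
    ∃ t', t'.Sublist t ∧ Valid G a t' ∧ lastv a t' = lastv a t ∧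
      (a :: t'.map Prod.snd).Nodup := by
  induction t generalizing a with
  | nil => exact ⟨[], List.Sublist.refl _, h, rfl, by simp⟩
  | cons s t ih =>
    obtain ⟨h1, h2⟩ := h
    obtain ⟨t', hs, hv, hl, hn⟩ := ih s.2 h2
    by_cases ha : a ∈ (s :: t').map Prod.snd
    · obtain ⟨x, hx, rfl⟩ := List.mem_map.1 ha
      obtain ⟨p, q, e⟩ := List.append_of_mem hx
      have hv' : Valid G x.2 (s :: t') := ⟨h1, hv⟩
      have hl' : lastv x.2 (s :: t') = lastv x.2 (s :: t) := hl
      have hn' : ((s :: t').map Prod.snd).Nodup := hn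
      have hs' : (s :: t').Sublist (s :: t) := hs.cons_cons s
      rw [e] at hv' hl' hn' hs'
      rw [valid_append] at hv'
      rw [lastv_append] at hl'
      refine ⟨q, ?_, hv'.2.2, hl', ?_⟩
      · exact ((List.sublist_cons_self x q).trans (List.sublist_append_right p _)).trans hs'
      · rw [List.map_append] at hn'
        exact (List.nodup_append.1 hn').2.1
    · exact ⟨s :: t', hs.cons_cons s, ⟨h1, hv⟩, hl, List.nodup_cons.2 ⟨ha, hn⟩⟩

theorem valid_trim (G : MixedGraph V) (t : List (EKind × V)) (a : V) (h : Valid G a t)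
    (hn : (a :: t.map Prod.snd).Nodup) : Valid G.trim a t := by
  induction t generalizing a with
  | nil => trivial
  | cons s t ih =>
    obtain ⟨h1, h2⟩ := h
    have hn2 := List.nodup_cons.1 hn
    refine ⟨?_, ih s.2 h2 hn2.2⟩
    obtain ⟨e, v⟩ := s
    cases e with
    | fwd => exact h1
    | bwd => exact h1
    | bidir =>
      refine ⟨h1, ?_⟩
      rintro rfl
      exact hn2.1 (by simp)

theorem valid_of_trim (G : MixedGraph V) (t : List (EKind × V)) (a : V)
    (h : Valid G.trim a t) : Valid G a t := by
  induction t generalizing a with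
  | nil => trivial
  | cons s t ih =>
    obtain ⟨h1, h2⟩ := h
    refine ⟨?_, ih s.2 h2⟩
    obtain ⟨e, v⟩ := s
    cases e with
    | fwd => exact h1
    | bwd => exact h1
    | bidir => exact h1.1

theorem walk_of_trim {G : MixedGraph V} {w : MWalk V} {j k : V}
    (h : IsWalkFrom G.trim w j k) : IsWalkFrom G w j k :=
  ⟨⟨h.1.1, valid_of_trim G _ _ h.1.2⟩, h.2⟩

theorem no_bidir {G : MixedGraph V} (hc : G.CanonicallyDirected) (t : List (EKind × V)) (a : V)
    (h : Valid G.trim a t) : ∀ s ∈ t, s.1 ≠ EKind.bidir := by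
  induction t generalizing a with
  | nil => simp
  | cons s t ih =>
    obtain ⟨h1, h2⟩ := h
    intro x hx
    rcases List.mem_cons.1 hx with rfl | hx
    · intro hb
      rw [hb] at h1
      exact h1.2 ((hc _ _).1 h1.1)
    · exact ih s.2 h2 x hx

theorem arc_to_path (G : MixedGraph V) {j k : V} {L : Set V} (hjk : j ≠ k) (hkL : k ∉ L)
    (h : ∃ w : MWalk V, MWalk.IsWalkFrom G w j k ∧ w.IsArc ∧ ∀ v ∈ w.interior, v ∉ L) :
    ∃ w : MWalk V, MWalk.IsWalkFrom G.trim w j k ∧ w.IsArc ∧ w.IsPath ∧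
        ∀ v ∈ w.interior, v ∉ L := by
  obtain ⟨⟨a, t⟩, ⟨⟨_, hv⟩, rfl, hl⟩, harc, hi⟩ := h
  rw [last_eq] at hl
  rw [interior_iff hkL t hl] at hi
  obtain ⟨t', hs, hv', hl', hn⟩ := shorten G t a hv
  rw [hl] at hl'
  have hne : t' ≠ [] := by
    rintro rfl
    exact hjk hl'
  refine ⟨⟨a, t'⟩, ⟨⟨hne, valid_trim G t' a hv' hn⟩, rfl, by rw [last_eq]; exact hl'⟩, ?_, hn, ?_⟩
  · rcases pairwise_shape t' ((arc_pairwise harc).sublist hs) with h | h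
    · exact Or.inl h
    · exact Or.inr ⟨hne, h⟩
  · rw [interior_iff hkL t' hl']
    exact fun s h => hi s (hs.subset h)

theorem arc_to_trek (G : MixedGraph V) (hcan : G.Canonical) {j k : V} {L : Set V}
    (hjL : j ∉ L) (hkL : k ∉ L)
    (h : ∃ w : MWalk V, MWalk.IsWalkFrom G w j k ∧ w.IsArc ∧ ∀ v ∈ w.interior, v ∉ L) :
    ∃ w : MWalk V, MWalk.IsWalkFrom G w j k ∧ w.IsTrek ∧ ∀ v ∈ w.interior, v ∉ L := by
  obtain ⟨⟨a, t⟩, hw, harc, hi⟩ := h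
  rcases harc with h | ⟨_, l, r, e, h1, h2⟩
  · exact ⟨_, hw, h, hi⟩
  obtain ⟨⟨_, hv⟩, rfl, hl⟩ := hw
  rw [last_eq] at hl
  rw [interior_iff hkL t hl] at hi
  dsimp only at e hv hjL hl
  subst e
  rw [valid_append] at hv
  have hl2 : lastv a (l ++ (EKind.bidir, lastv a l) :: r) = k := by
    rw [← hl, lastv_append, lastv_append]; rfl
  refine ⟨⟨a, l ++ (EKind.bidir, lastv a l) :: r⟩, ⟨⟨by simp, ?_⟩, rfl, ?_⟩,
    ⟨l, _, r, rfl, h1, rfl, h2⟩, ?_⟩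
  · rw [valid_append]
    exact ⟨hv.1, hcan _, hv.2⟩
  · rw [last_eq]; exact hl2
  · rw [interior_iff hkL _ hl2]
    intro s hs
    rcases List.mem_append.1 hs with hs | hs
    · exact hi s (List.mem_append_left _ hs)
    · rcases List.mem_cons.1 hs with rfl | hs
      · rcases List.mem_cons.1 (lastv_mem a l) with h | h
        · dsimp only; rw [h]; exact hjL
        · obtain ⟨x, hx, hx2⟩ := List.mem_map.1 h
          dsimp only
          rw [← hx2]
          exact hi x (List.mem_append_left _ hx)
      · exact hi s (List.mem_append_right _ hs)

end TrekAux

/-- Equivalent characterizations of trek/arc/d-connection in canonical graphs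
(and canonically directed acyclic graphs), with or without trimming bidirected
loops and with or without restricting to paths. -/
theorem trek_exist_tfae {V : Type*} (G : MixedGraph V) (hsymm : G.BiSymm)
    (hcan : G.Canonical) (j k : V) (L : Set V)
    (hjk : j ≠ k) (hjL : j ∉ L) (hkL : k ∉ L) :
    [(∃ w : MWalk V, MWalk.IsWalkFrom G w j k ∧ w.IsTrek ∧ ∀ v ∈ w.interior, v ∉ L),
     (∃ w : MWalk V, MWalk.IsWalkFrom G w j k ∧ w.IsArc ∧ ∀ v ∈ w.interior, v ∉ L),
     (∃ w : MWalk V, MWalk.IsWalkFrom G w j k ∧ w.IsArc ∧ w.IsPath ∧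
        ∀ v ∈ w.interior, v ∉ L),
     (∃ w : MWalk V, MWalk.IsWalkFrom G.trim w j k ∧ w.IsArc ∧ ∀ v ∈ w.interior, v ∉ L),
     (∃ w : MWalk V, MWalk.IsWalkFrom G.trim w j k ∧ w.IsArc ∧ w.IsPath ∧
        ∀ v ∈ w.interior, v ∉ L)].TFAE ∧
    (G.CanonicallyDirected → G.Acyclic →
      [(∃ w : MWalk V, MWalk.IsWalkFrom G w j k ∧ w.IsTrek ∧ ∀ v ∈ w.interior, v ∉ L),
       (∃ w : MWalk V, MWalk.IsWalkFrom G w j k ∧ w.IsDConnWalk ∧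
          ∀ v ∈ w.interior, v ∉ L),
       (∃ w : MWalk V, MWalk.IsWalkFrom G w j k ∧ w.IsDConnWalk ∧ w.IsPath ∧
          ∀ v ∈ w.interior, v ∉ L),
       (∃ w : MWalk V, MWalk.IsWalkFrom G.trim w j k ∧ w.IsDConnWalk ∧
          ∀ v ∈ w.interior, v ∉ L),
       (∃ w : MWalk V, MWalk.IsWalkFrom G.trim w j k ∧ w.IsDConnWalk ∧ w.IsPath ∧
          ∀ v ∈ w.interior, v ∉ L)].TFAE) := by
  have h25 := TrekAux.arc_to_path G (j := j) (k := k) (L := L) hjk hkL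
  have h21 := TrekAux.arc_to_trek G hcan (j := j) (k := k) (L := L) hjL hkL
  constructor
  · tfae_have 1 → 2 := fun ⟨w, a, b, c⟩ => ⟨w, a, Or.inl b, c⟩
    tfae_have 2 → 1 := h21
    tfae_have 2 → 5 := h25
    tfae_have 5 → 4 := fun ⟨w, a, b, _, c⟩ => ⟨w, a, b, c⟩
    tfae_have 4 → 2 := fun ⟨w, a, b, c⟩ => ⟨w, TrekAux.walk_of_trim a, b, c⟩
    tfae_have 5 → 3 := fun ⟨w, a, b, d, c⟩ => ⟨w, TrekAux.walk_of_trim a, b, d, c⟩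
    tfae_have 3 → 2 := fun ⟨w, a, b, _, c⟩ => ⟨w, a, b, c⟩
    tfae_finish
  · intro hc _
    tfae_have 1 → 5 := by
      rintro ⟨w, a, b, c⟩
      obtain ⟨w, a, b, d, c⟩ := h25 ⟨w, a, Or.inl b, c⟩
      refine ⟨w, a, ?_, d, c⟩
      rcases b with ⟨l, x, r, e, _, hb, _⟩ | b
      · exact absurd hb (TrekAux.no_bidir hc _ _ a.1.2 x (by simp [e]))
      · exact b
    tfae_have 2 → 1 := fun ⟨w, a, b, c⟩ => h21 ⟨w, a, Or.inr b, c⟩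
    tfae_have 5 → 4 := fun ⟨w, a, b, _, c⟩ => ⟨w, a, b, c⟩
    tfae_have 4 → 2 := fun ⟨w, a, b, c⟩ => ⟨w, TrekAux.walk_of_trim a, b, c⟩
    tfae_have 5 → 3 := fun ⟨w, a, b, d, c⟩ => ⟨w, TrekAux.walk_of_trim a, b, d, c⟩
    tfae_have 3 → 2 := fun ⟨w, a, b, _, c⟩ => ⟨w, a, b, c⟩
    tfae_finish
end

section
/- Let G be a directed mixed graph and L ⊆ Ṽ ⊆ V, J, K ⊆ Ṽ. Then: (a) there is a right-directed walk from some j ∈ J to some k ∈ K with no non-endpoint in L in marg_Ṽ(G) if and only if there is such a walk in G; (b) the same equivalence holds for left-directed walks; (c) there is a trek from some j ∈ J to some k ∈ K with no non-endpoint in L in marg_Ṽ(G) if and only if there is such a trek in G. -/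
namespace MargAux

variable {V : Type*}

inductive R (G : MixedGraph V) (L : Set V) : V → V → Prop
  | single {a b : V} (h : G.dir a b) : R G L a b
  | cons {a b c : V} (h : G.dir a b) (hb : b ∉ L) (hr : R G L b c) : R G L a c

theorem R.trans {G : MixedGraph V} {L : Set V} {a b c : V} (h : R G L a b) (hb : b ∉ L)
    (h2 : R G L b c) : R G L a c := by
  induction h with
  | single h => exact .cons h hb h2
  | cons h hb' _ ih => exact .cons h hb' (ih hb h2)

theorem R.mono {G : MixedGraph V} {L T : Set V} (hL : L ⊆ T) {a b : V} (h : R G T a b) :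
    R G L a b := by
  induction h with
  | single h => exact .single h
  | cons h hb' _ ih => exact .cons h (fun h => hb' (hL h)) ih

/-- possibly empty leg -/
def R0 (G : MixedGraph V) (L : Set V) (a b : V) : Prop := a = b ∨ (a ∉ L ∧ R G L a b)

theorem R0.mono {G : MixedGraph V} {L T : Set V} (hL : L ⊆ T) {a b : V} (h : R0 G T a b) :
    R0 G L a b := h.imp id (fun h => ⟨fun h' => h.1 (hL h'), h.2.mono hL⟩)

theorem R0.trans {G : MixedGraph V} {L : Set V} {a b c : V} (h : R0 G L a b)
    (h2 : R0 G L b c) : R0 G L a c := by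
  rcases h with rfl | h
  · exact h2
  · rcases h2 with rfl | h2
    · exact Or.inr h
    · exact Or.inr ⟨h.1, h.2.trans h2.1 h2.2⟩

def TR (G : MixedGraph V) (L : Set V) (a c : V) : Prop :=
  ∃ x y, G.bi x y ∧ R0 G L x a ∧ R0 G L y c

/-- existence of step lists -/
def WE (P : List (EKind × V) → Prop) (G : MixedGraph V) (L : Set V) (a c : V) : Prop :=
  ∃ t : List (EKind × V), t ≠ [] ∧ MWalk.Valid G a t ∧ (t.map Prod.snd).getLastD a = c ∧ P t ∧
    ∀ v ∈ (t.map Prod.snd).dropLast, v ∉ L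

def PR (t : List (EKind × V)) : Prop := ∀ s ∈ t, s.1 = EKind.fwd
def PL (t : List (EKind × V)) : Prop := ∀ s ∈ t, s.1 = EKind.bwd
def PT (w : List (EKind × V)) : Prop :=
  ∃ (l : List (EKind × V)) (b : EKind × V) (r : List (EKind × V)),
    w = l ++ b :: r ∧ (∀ s ∈ l, s.1 = EKind.bwd) ∧ b.1 = EKind.bidir ∧
      (∀ s ∈ r, s.1 = EKind.fwd)

theorem WE_iff (P : List (EKind × V) → Prop) (G : MixedGraph V) (L : Set V) (a c : V) :
    (∃ w : MWalk V, MWalk.IsWalkFrom G w a c ∧ P w.tail ∧ ∀ v ∈ w.interior, v ∉ L) ↔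
      WE P G L a c := by
  constructor
  · rintro ⟨⟨h, t⟩, ⟨⟨h1, h2⟩, rfl, h4⟩, h5, h6⟩
    exact ⟨t, h1, h2, h4, h5, h6⟩
  · rintro ⟨t, h1, h2, h4, h5, h6⟩
    exact ⟨⟨a, t⟩, ⟨⟨h1, h2⟩, rfl, h4⟩, h5, h6⟩

theorem WE.bwd {P : List (EKind × V) → Prop} (hP : ∀ t v, P t → P ((EKind.bwd, v) :: t))
    {G : MixedGraph V} {L : Set V} {x a c : V} (h : R G L x a) (hx : x ∉ L) (hw : WE P G L x c) :
    WE P G L a c := by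
  have key : ∀ {x a : V}, G.dir x a → x ∉ L → WE P G L x c → WE P G L a c := by
    rintro x a h hx ⟨t, h1, h2, h4, h5, h6⟩
    refine ⟨(EKind.bwd, x) :: t, by simp, ⟨h, h2⟩, ?_, hP _ _ h5, ?_⟩
    · simpa only [List.map_cons, List.getLastD_cons] using h4
    · rw [List.map_cons, List.dropLast_cons_of_ne_nil (by simpa using h1)]
      intro v hv
      rcases List.mem_cons.1 hv with rfl | hv
      · exact hx
      · exact h6 v hv
  induction h with
  | single h => exact key h hx hw
  | cons h hb _ ih => exact ih hb (key h hx hw)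

theorem right_iff (G : MixedGraph V) (L : Set V) (a c : V) : WE PR G L a c ↔ R G L a c := by
  constructor
  · rintro ⟨t, h1, h2, h4, h5, h6⟩
    induction t generalizing a with
    | nil => exact absurd rfl h1
    | cons s t ih =>
      obtain ⟨k, v⟩ := s
      obtain rfl : k = EKind.fwd := h5 (k, v) (by simp)
      obtain ⟨hd, h2⟩ := h2
      rw [List.map_cons, List.getLastD_cons] at h4
      by_cases ht : t = []
      · subst ht
        simp at h4
        subst h4
        exact .single hd
      · rw [List.map_cons, List.dropLast_cons_of_ne_nil (by simpa using ht)] at h6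
        exact .cons hd (h6 v (by simp)) (ih v ht h2 h4 (fun s hs => h5 s (by simp [hs]))
          (fun u hu => h6 u (by simp only [List.mem_cons]; exact Or.inr hu)))
  · intro h
    induction h with
    | @single a b h =>
      exact ⟨[(EKind.fwd, b)], by simp, ⟨h, trivial⟩, by simp, by simp [PR], by simp⟩
    | @cons a b c h hb _ ih =>
      obtain ⟨t, h1, h2, h4, h5, h6⟩ := ih
      refine ⟨(EKind.fwd, b) :: t, by simp, ⟨h, h2⟩, ?_, ?_, ?_⟩
      · simpa only [List.map_cons, List.getLastD_cons] using h4
      · intro s hs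
        rcases List.mem_cons.1 hs with rfl | hs
        · rfl
        · exact h5 s hs
      · rw [List.map_cons, List.dropLast_cons_of_ne_nil (by simpa using h1)]
        intro v hv
        rcases List.mem_cons.1 hv with rfl | hv
        · exact hb
        · exact h6 v hv

theorem left_iff (G : MixedGraph V) (L : Set V) (a c : V) : WE PL G L a c ↔ R G L c a := by
  constructor
  · rintro ⟨t, h1, h2, h4, h5, h6⟩
    induction t generalizing a with
    | nil => exact absurd rfl h1
    | cons s t ih =>
      obtain ⟨k, v⟩ := s
      obtain rfl : k = EKind.bwd := h5 (k, v) (by simp)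
      obtain ⟨hd, h2⟩ := h2
      rw [List.map_cons, List.getLastD_cons] at h4
      by_cases ht : t = []
      · subst ht
        simp at h4
        subst h4
        exact .single hd
      · rw [List.map_cons, List.dropLast_cons_of_ne_nil (by simpa using ht)] at h6
        exact (ih v ht h2 h4 (fun s hs => h5 s (by simp [hs]))
          (fun u hu => h6 u (by simp only [List.mem_cons]; exact Or.inr hu))).trans
            (h6 v (by simp)) (.single hd)
  · intro h
    have key : ∀ {a b : V}, G.dir b a → WE PL G L a b := fun {a b} h =>
      ⟨[(EKind.bwd, b)], by simp, ⟨h, trivial⟩, by simp, by simp [PL], by simp⟩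
    cases h with
    | single h => exact key h
    | cons h hb hr =>
      refine WE.bwd ?_ hr hb (key h)
      intro t v ht s hs
      rcases List.mem_cons.1 hs with rfl | hs
      · rfl
      · exact ht s hs

theorem trek_iff (G : MixedGraph V) (L : Set V) (a c : V) : WE PT G L a c ↔ TR G L a c := by
  constructor
  · rintro ⟨t, h1, h2, h4, ⟨l, b, r, rfl, hl, hb, hr⟩, h6⟩
    clear h1
    induction l generalizing a with
    | nil =>
      obtain ⟨k, v⟩ := b
      obtain rfl : k = EKind.bidir := hb
      obtain ⟨hd, h2⟩ := h2
      rw [List.nil_append, List.map_cons] at h4 h6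
      rw [List.getLastD_cons] at h4
      refine ⟨a, v, hd, Or.inl rfl, ?_⟩
      by_cases ht : r = []
      · subst ht
        exact Or.inl (by simpa using h4)
      · rw [List.dropLast_cons_of_ne_nil (by simpa using ht)] at h6
        exact Or.inr ⟨h6 v (by simp), (right_iff G L v c).1 ⟨r, ht, h2, h4, hr,
          (fun u hu => h6 u (by simp only [List.mem_cons]; exact Or.inr hu))⟩⟩
    | cons s l ih =>
      obtain ⟨k, v⟩ := s
      obtain rfl : k = EKind.bwd := hl (k, v) (by simp)
      obtain ⟨hd, h2⟩ := h2
      rw [List.cons_append, List.map_cons] at h4 h6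
      rw [List.getLastD_cons] at h4
      rw [List.dropLast_cons_of_ne_nil (by simp)] at h6
      obtain ⟨x, y, h, hx, hy⟩ := ih v h2 h4
          (fun u hu => h6 u (by simp only [List.mem_cons]; exact Or.inr hu))
          (fun s hs => hl s (by simp [hs]))
      exact ⟨x, y, h, hx.trans (Or.inr ⟨h6 v (by simp), .single hd⟩), hy⟩
  · rintro ⟨x, y, h, hx, hy⟩
    have key : WE PT G L x c := by
      rcases hy with rfl | ⟨hy, hr⟩
      · exact ⟨[(EKind.bidir, y)], by simp, ⟨h, trivial⟩, by simp,
          ⟨[], _, [], rfl, by simp, rfl, by simp⟩, by simp⟩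
      · obtain ⟨t, h1, h2, h4, h5, h6⟩ := (right_iff G L y c).2 hr
        refine ⟨(EKind.bidir, y) :: t, by simp, ⟨h, h2⟩, ?_, ⟨[], _, t, rfl, by simp, rfl, h5⟩, ?_⟩
        · simpa only [List.map_cons, List.getLastD_cons] using h4
        · rw [List.map_cons, List.dropLast_cons_of_ne_nil (by simpa using h1)]
          intro v hv
          rcases List.mem_cons.1 hv with rfl | hv
          · exact hy
          · exact h6 v hv
    rcases hx with rfl | ⟨hx, hr⟩
    · exact key
    · refine WE.bwd ?_ hr hx key
      rintro t v ⟨l, b, r, rfl, hl, hb, hr⟩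
      refine ⟨(EKind.bwd, v) :: l, b, r, rfl, ?_, hb, hr⟩
      intro s hs
      rcases List.mem_cons.1 hs with rfl | hs
      · rfl
      · exact hl s hs

theorem marg_dir (G : MixedGraph V) (T : Set V) (a c : V) :
    (G.marg T).dir a c ↔ a ∈ T ∧ c ∈ T ∧ R G T a c := by
  rw [← right_iff, ← WE_iff]; rfl

theorem marg_bi (G : MixedGraph V) (T : Set V) (a c : V) :
    (G.marg T).bi a c ↔ a ∈ T ∧ c ∈ T ∧ TR G T a c := by
  rw [← trek_iff, ← WE_iff]; rfl

theorem R_of_marg {G : MixedGraph V} {T L : Set V} (hL : L ⊆ T) {a c : V}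
    (h : R (G.marg T) L a c) : R G L a c := by
  induction h with
  | single h => exact ((marg_dir ..).1 h).2.2.mono hL
  | cons h hb _ ih => exact (((marg_dir ..).1 h).2.2.mono hL).trans hb ih

theorem R_decomp {G : MixedGraph V} {T L : Set V} {a c : V} (hc : c ∈ T)
    (h : R G L a c) : ∃ m ∈ T, R G T a m ∧ R0 (G.marg T) L m c := by
  induction h with
  | single h => exact ⟨_, hc, .single h, Or.inl rfl⟩
  | @cons a b c h hb _ ih =>
    obtain ⟨m, hm, h1, h2⟩ := ih hc
    by_cases hbT : b ∈ T
    · refine ⟨b, hbT, .single h, Or.inr ⟨hb, ?_⟩⟩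
      have hd := (marg_dir G T b m).2 ⟨hbT, hm, h1⟩
      rcases h2 with rfl | h2
      · exact .single hd
      · exact .cons hd h2.1 h2.2
    · exact ⟨m, hm, .cons h hbT h1, h2⟩

theorem R_marg {G : MixedGraph V} {T L : Set V} (hL : L ⊆ T) {a c : V} (ha : a ∈ T) (hc : c ∈ T) :
    R (G.marg T) L a c ↔ R G L a c := by
  refine ⟨R_of_marg hL, fun h => ?_⟩
  obtain ⟨m, hm, h1, h2⟩ := R_decomp hc h
  have hd := (marg_dir G T a m).2 ⟨ha, hm, h1⟩
  rcases h2 with rfl | h2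
  · exact .single hd
  · exact .cons hd h2.1 h2.2

theorem R0_decomp {G : MixedGraph V} {T L : Set V} (hL : L ⊆ T) {a c : V} (hc : c ∈ T)
    (h : R0 G L a c) : ∃ m ∈ T, R0 G T a m ∧ R0 (G.marg T) L m c := by
  rcases h with rfl | ⟨ha, h⟩
  · exact ⟨a, hc, Or.inl rfl, Or.inl rfl⟩
  · by_cases haT : a ∈ T
    · exact ⟨a, haT, Or.inl rfl, Or.inr ⟨ha, (R_marg hL haT hc).2 h⟩⟩
    · obtain ⟨m, hm, h1, h2⟩ := R_decomp hc h
      exact ⟨m, hm, Or.inr ⟨haT, h1⟩, h2⟩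

theorem R0_of_marg {G : MixedGraph V} {T L : Set V} (hL : L ⊆ T) {a c : V}
    (h : R0 (G.marg T) L a c) : R0 G L a c := h.imp id (fun h => ⟨h.1, R_of_marg hL h.2⟩)

theorem TR_marg {G : MixedGraph V} {T L : Set V} (hL : L ⊆ T) {a c : V} (ha : a ∈ T) (hc : c ∈ T) :
    TR (G.marg T) L a c ↔ TR G L a c := by
  constructor
  · rintro ⟨x, y, h, hx, hy⟩
    obtain ⟨_, _, x', y', h', hx', hy'⟩ := (marg_bi ..).1 h
    exact ⟨x', y', h', (hx'.mono hL).trans (R0_of_marg hL hx),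
      (hy'.mono hL).trans (R0_of_marg hL hy)⟩
  · rintro ⟨x, y, h, hx, hy⟩
    obtain ⟨m, hm, h1, h2⟩ := R0_decomp hL ha hx
    obtain ⟨n, hn, h3, h4⟩ := R0_decomp hL hc hy
    exact ⟨m, n, (marg_bi ..).2 ⟨hm, hn, x, y, h, h1, h3⟩, h2, h4⟩

end MargAux

/-- Marginalization preserves unblocked right-directed walks, left-directed
walks, and treks. -/
theorem marg_preserves_walks {V : Type*} (G : MixedGraph V) (hsymm : G.BiSymm)
    (T J K L : Set V) (hJ : J ⊆ T) (hK : K ⊆ T) (hL : L ⊆ T) :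
    ((∃ j ∈ J, ∃ k ∈ K, ∃ w : MWalk V, MWalk.IsWalkFrom (G.marg T) w j k ∧
        w.IsRightDirected ∧ ∀ v ∈ w.interior, v ∉ L) ↔
      (∃ j ∈ J, ∃ k ∈ K, ∃ w : MWalk V, MWalk.IsWalkFrom G w j k ∧
        w.IsRightDirected ∧ ∀ v ∈ w.interior, v ∉ L)) ∧
    ((∃ j ∈ J, ∃ k ∈ K, ∃ w : MWalk V, MWalk.IsWalkFrom (G.marg T) w j k ∧
        w.IsLeftDirected ∧ ∀ v ∈ w.interior, v ∉ L) ↔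
      (∃ j ∈ J, ∃ k ∈ K, ∃ w : MWalk V, MWalk.IsWalkFrom G w j k ∧
        w.IsLeftDirected ∧ ∀ v ∈ w.interior, v ∉ L)) ∧
    ((∃ j ∈ J, ∃ k ∈ K, ∃ w : MWalk V, MWalk.IsWalkFrom (G.marg T) w j k ∧
        w.IsTrek ∧ ∀ v ∈ w.interior, v ∉ L) ↔
      (∃ j ∈ J, ∃ k ∈ K, ∃ w : MWalk V, MWalk.IsWalkFrom G w j k ∧
        w.IsTrek ∧ ∀ v ∈ w.interior, v ∉ L)) := by
  refine ⟨?_, ?_, ?_⟩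
  · refine exists_congr fun j => and_congr_right fun hj => exists_congr fun k =>
      and_congr_right fun hk => ?_
    exact (MargAux.WE_iff MargAux.PR _ L j k).trans ((MargAux.right_iff ..).trans
      ((MargAux.R_marg hL (hJ hj) (hK hk)).trans ((MargAux.right_iff ..).symm.trans
        (MargAux.WE_iff MargAux.PR _ L j k).symm)))
  · refine exists_congr fun j => and_congr_right fun hj => exists_congr fun k =>
      and_congr_right fun hk => ?_
    exact (MargAux.WE_iff MargAux.PL _ L j k).trans ((MargAux.left_iff ..).trans
      ((MargAux.R_marg hL (hK hk) (hJ hj)).trans ((MargAux.left_iff ..).symm.trans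
        (MargAux.WE_iff MargAux.PL _ L j k).symm)))
  · refine exists_congr fun j => and_congr_right fun hj => exists_congr fun k =>
      and_congr_right fun hk => ?_
    exact (MargAux.WE_iff MargAux.PT _ L j k).trans ((MargAux.trek_iff ..).trans
      ((MargAux.TR_marg hL (hJ hj) (hK hk)).trans ((MargAux.trek_iff ..).symm.trans
        (MargAux.WE_iff MargAux.PT _ L j k).symm)))
end

section
/- Let G be an acyclic directed mixed graph with no bidirected loops (an ADMG) and let L ⊆ Ṽ ⊆ V and j, k ∈ Ṽ. Then each of the following kinds of path from j to k, not blocked by L, exists in marg*_Ṽ(G) if and only if a path of the same kind from j to k, not blocked by L, exists in G: (a) right-directed paths; (b) left-directed paths; (c) arc paths with an arrowhead at both endpoints (arcs that are neither right-directed nor left-directed); (d) arc paths. -/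
/-- The ADMG-marginal graph: vertex set `T`, a directed edge `j → k` iff some
right-directed path from `j` to `k` in `G` has all its non-endpoints outside
`T`, and a bidirected edge `j ↔ k` iff some arc path from `j` to `k` in `G`
that is neither right-directed nor left-directed has all its non-endpoints
outside `T`. -/
def MixedGraph.margStar {V : Type*} (G : MixedGraph V) (T : Set V) : MixedGraph V where
  dir j k := j ∈ T ∧ k ∈ T ∧ ∃ w : MWalk V, MWalk.IsWalkFrom G w j k ∧
      w.IsRightDirected ∧ w.IsPath ∧ ∀ v ∈ w.interior, v ∉ T
  bi j k := j ∈ T ∧ k ∈ T ∧ ∃ w : MWalk V, MWalk.IsWalkFrom G w j k ∧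
      w.IsArc ∧ ¬ w.IsRightDirected ∧ ¬ w.IsLeftDirected ∧ w.IsPath ∧
      ∀ v ∈ w.interior, v ∉ T

namespace MSP

open Relation

variable {V : Type*}

theorem rtg_mono {R S : V → V → Prop} (h : ∀ x y, R x y → S x y) {x y : V}
    (hr : ReflTransGen R x y) : ReflTransGen S x y := by
  induction hr with
  | refl => exact ReflTransGen.refl
  | tail _ h2 ih => exact ReflTransGen.tail ih (h _ _ h2)

theorem tg_mono {R S : V → V → Prop} (h : ∀ x y, R x y → S x y) {x y : V}
    (hr : TransGen R x y) : TransGen S x y := by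
  induction hr with
  | single h2 => exact TransGen.single (h _ _ h2)
  | tail _ h2 ih => exact TransGen.tail ih (h _ _ h2)

/-- Reachability along `R`-edges whose sources satisfy `P`. -/
def Rch (R : V → V → Prop) (P : V → Prop) : V → V → Prop :=
  ReflTransGen (fun x y => R x y ∧ P x)

/-- Directed connection with nonendpoints satisfying `P`. -/
def DD (G : MixedGraph V) (P : V → Prop) (j k : V) : Prop :=
  ∃ c, G.dir j c ∧ Rch G.dir P c k

/-- Bi-arrowheaded connection. -/
def Mid (G : MixedGraph V) (L : Set V) (j k : V) : Prop :=
  j ≠ k ∧ ∃ a b, (a = b ∨ G.bi a b) ∧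
    Rch G.dir (fun x => x ∉ L ∧ x ≠ j ∧ x ≠ k) a j ∧
    Rch G.dir (fun x => x ∉ L ∧ x ≠ j ∧ x ≠ k) b k

def lastOf (x : V) (t : List (EKind × V)) : V := (t.map Prod.snd).getLastD x

theorem lastOf_nil (x : V) : lastOf x [] = x := rfl

theorem lastOf_cons (x : V) (s : EKind × V) (t : List (EKind × V)) :
    lastOf x (s :: t) = lastOf s.2 t := by
  simp only [lastOf, List.map_cons, List.getLastD_cons]

theorem lastOf_append (x : V) (t u : List (EKind × V)) :
    lastOf x (t ++ u) = lastOf (lastOf x t) u := by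
  induction t generalizing x with
  | nil => rfl
  | cons s t ih => rw [List.cons_append, lastOf_cons, lastOf_cons, ih]

theorem lastOf_mem (x : V) (t : List (EKind × V)) (ht : t ≠ []) :
    lastOf x t ∈ t.map Prod.snd := by
  induction t generalizing x with
  | nil => exact absurd rfl ht
  | cons s t ih =>
    rw [lastOf_cons]
    by_cases h : t = []
    · subst h; simp [lastOf_nil]
    · exact List.mem_cons_of_mem _ (ih _ h)

theorem valid_append (G : MixedGraph V) (x : V) (t u : List (EKind × V)) :
    MWalk.Valid G x (t ++ u) ↔ MWalk.Valid G x t ∧ MWalk.Valid G (lastOf x t) u := by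
  induction t generalizing x with
  | nil => simp [MWalk.Valid, lastOf_nil]
  | cons s t ih => simp only [List.cons_append, MWalk.Valid, lastOf_cons, ih, and_assoc]

theorem mem_dropLast_ne (x : V) (t : List (EKind × V)) (hn : (x :: t.map Prod.snd).Nodup)
    (v : V) (hv : v ∈ (t.map Prod.snd).dropLast) : v ≠ x ∧ v ≠ lastOf x t := by
  induction t generalizing x with
  | nil => simp at hv
  | cons s t ih =>
    rw [lastOf_cons]
    have hn' := hn
    rw [List.nodup_cons] at hn
    refine ⟨fun h => hn.1 (h ▸ List.mem_of_mem_dropLast hv), ?_⟩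
    by_cases h : t = []
    · subst h; simp at hv
    · have h' : t.map Prod.snd ≠ [] := by simpa using h
      rw [List.map_cons, List.dropLast_cons_of_ne_nil h'] at hv
      rcases List.mem_cons.1 hv with hv | hv
      · subst hv
        intro e
        have := hn.2
        rw [List.map_cons, List.nodup_cons] at this
        exact this.1 (e ▸ lastOf_mem _ _ h)
      · exact (ih s.2 hn.2 hv).2

theorem fwd_leg (G : MixedGraph V) (P : V → Prop) (x : V) (t : List (EKind × V))
    (hv : MWalk.Valid G x t) (hf : ∀ s ∈ t, s.1 = EKind.fwd)
    (hP : ∀ v ∈ (x :: t.map Prod.snd).dropLast, P v) : Rch G.dir P x (lastOf x t) := by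
  induction t generalizing x with
  | nil => exact ReflTransGen.refl
  | cons s t ih =>
    obtain ⟨e, y⟩ := s
    have he : e = EKind.fwd := hf (e, y) (by simp)
    subst he
    rw [lastOf_cons]
    refine ReflTransGen.head (b := y) ⟨hv.1, hP x (by simp)⟩
      (ih y hv.2 (fun s hs => hf s (List.mem_cons_of_mem _ hs)) ?_)
    intro v hv'
    apply hP
    simp only [List.map_cons] at *
    rw [List.dropLast_cons_of_ne_nil (by simp)]
    exact List.mem_cons_of_mem _ hv'

theorem bwd_leg (G : MixedGraph V) (P : V → Prop) (x : V) (t : List (EKind × V))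
    (hv : MWalk.Valid G x t) (hf : ∀ s ∈ t, s.1 = EKind.bwd)
    (hP : ∀ v ∈ t.map Prod.snd, P v) : Rch G.dir P (lastOf x t) x := by
  induction t generalizing x with
  | nil => exact ReflTransGen.refl
  | cons s t ih =>
    obtain ⟨e, y⟩ := s
    have he : e = EKind.bwd := hf (e, y) (by simp)
    subst he
    rw [lastOf_cons]
    exact ReflTransGen.tail
      (ih y hv.2 (fun s hs => hf s (List.mem_cons_of_mem _ hs))
        (fun v hv => hP v (List.mem_cons_of_mem _ hv))) ⟨hv.1, hP y (by simp)⟩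

theorem bwd_walk (G : MixedGraph V) (P : V → Prop) (x : V) (t : List (EKind × V))
    (hne : t ≠ [])
    (hv : MWalk.Valid G x t) (hf : ∀ s ∈ t, s.1 = EKind.bwd)
    (hP : ∀ v ∈ (t.map Prod.snd).dropLast, P v) : DD G P (lastOf x t) x := by
  induction t generalizing x with
  | nil => exact absurd rfl hne
  | cons s t ih =>
    obtain ⟨e, y⟩ := s
    have he : e = EKind.bwd := hf (e, y) (by simp)
    subst he
    rw [lastOf_cons]
    by_cases h : t = []
    · subst h; exact ⟨x, hv.1, ReflTransGen.refl⟩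
    · have h' : t.map Prod.snd ≠ [] := by simpa using h
      rw [List.map_cons, List.dropLast_cons_of_ne_nil h'] at hP
      obtain ⟨c, h1, h2⟩ := ih y h hv.2 (fun s hs => hf s (List.mem_cons_of_mem _ hs))
        (fun v hv => hP v (List.mem_cons_of_mem _ hv))
      exact ⟨c, h1, ReflTransGen.tail h2 ⟨hv.1, hP y (by simp)⟩⟩

/-- A path from `x` to `k`, interior in `P`, with step list in `Q`. -/
def I (G : MixedGraph V) (P : V → Prop) (k : V) (Q : List (EKind × V) → Prop) (x : V)
    (t : List (EKind × V)) : Prop :=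
  MWalk.Valid G x t ∧ lastOf x t = k ∧ (x :: t.map Prod.snd).Nodup ∧
    (∀ v ∈ (t.map Prod.snd).dropLast, P v) ∧ Q t

def SufClosed (Q : List (EKind × V) → Prop) : Prop := ∀ s t, Q (s :: t) → Q t

def Edge (G : MixedGraph V) (z : V) (e : EKind) (x : V) : Prop := MWalk.Valid G z [(e, x)]

theorem I.mono {G : MixedGraph V} {P : V → Prop} {k : V} {Q Q' : List (EKind × V) → Prop} {x : V}
    {t : List (EKind × V)} (h : I G P k Q x t) (hQ : Q t → Q' t) : I G P k Q' x t :=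
  ⟨h.1, h.2.1, h.2.2.1, h.2.2.2.1, hQ h.2.2.2.2⟩

theorem I.nil (G : MixedGraph V) (P : V → Prop) (k : V) (Q : List (EKind × V) → Prop)
    (h : Q []) : I G P k Q k [] := ⟨trivial, rfl, by simp, by simp, h⟩

theorem I.ne_nil {G : MixedGraph V} {P : V → Prop} {k : V} {Q : List (EKind × V) → Prop} {x : V}
    {t : List (EKind × V)} (h : I G P k Q x t) (hx : x ≠ k) : t ≠ [] := by
  rintro rfl; exact hx h.2.1

theorem I.verts {G : MixedGraph V} {P : V → Prop} {k : V} {Q : List (EKind × V) → Prop} {x : V}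
    {t : List (EKind × V)} (h : I G P k Q x t) (hx : x = k ∨ P x) :
    ∀ v ∈ x :: t.map Prod.snd, v = k ∨ P v := by
  have hl := h.2.1
  have hP := h.2.2.2.1
  clear h
  intro v hv
  rcases List.mem_cons.1 hv with rfl | hv'
  · exact hx
  · clear hx hv
    rename' hv' => hv
    induction t generalizing x with
    | nil => simp at hv
    | cons s t ih =>
      rw [lastOf_cons] at hl
      by_cases h : t = []
      · subst h; simp at hv; subst hv; exact Or.inl hl
      · have h' : t.map Prod.snd ≠ [] := by simpa using h
        rw [List.map_cons, List.dropLast_cons_of_ne_nil h'] at hP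
        rcases List.mem_cons.1 hv with rfl | hv
        · exact Or.inr (hP _ (by simp))
        · exact ih (x := s.2) hl
            (fun v hv => hP v (List.mem_cons_of_mem _ hv)) hv

theorem I.cons {G : MixedGraph V} {P : V → Prop} {k : V} {Q Q' : List (EKind × V) → Prop} {x : V}
    {t : List (EKind × V)} (h : I G P k Q x t) (hx : x = k ∨ P x) (z : V) (e : EKind)
    (he : Edge G z e x) (hz : z ∉ x :: t.map Prod.snd) (hQ : Q t → Q' ((e, x) :: t)) :
    I G P k Q' z ((e, x) :: t) := by
  obtain ⟨hv, hl, hn, hP, hq⟩ := h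
  refine ⟨⟨he.1, hv⟩, by rw [lastOf_cons]; exact hl, List.nodup_cons.2 ⟨hz, hn⟩, ?_, hQ hq⟩
  by_cases h : t = []
  · subst h; simp
  · have h' : t.map Prod.snd ≠ [] := by simpa using h
    rw [List.map_cons, List.dropLast_cons_of_ne_nil h']
    intro v hv'
    rcases List.mem_cons.1 hv' with rfl | hv'
    · rcases hx with rfl | hx
      · exact absurd (lastOf_mem _ _ h) (by rw [hl]; exact (List.nodup_cons.1 hn).1)
      · exact hx
    · exact hP v hv'

theorem I.cut {G : MixedGraph V} {P : V → Prop} {k : V} {Q : List (EKind × V) → Prop} {x : V}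
    {t : List (EKind × V)} (hQ : SufClosed Q) (h : I G P k Q x t) (z : V)
    (hz : z ∈ x :: t.map Prod.snd) : ∃ t', I G P k Q z t' := by
  induction t generalizing x with
  | nil => simp at hz; subst hz; exact ⟨_, h⟩
  | cons s t ih =>
    rcases List.mem_cons.1 hz with rfl | hz
    · exact ⟨_, h⟩
    · obtain ⟨hv, hl, hn, hP, hq⟩ := h
      refine ih (x := s.2) ⟨hv.2, by rw [lastOf_cons] at hl; exact hl, (List.nodup_cons.1 hn).2,
        ?_, hQ _ _ hq⟩ hz
      intro v hv
      apply hP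
      by_cases h : t = []
      · subst h; simp at hv
      · have h' : t.map Prod.snd ≠ [] := by simpa using h
        rw [List.map_cons, List.dropLast_cons_of_ne_nil h']
        exact List.mem_cons_of_mem _ hv

theorem I.extend {G : MixedGraph V} {P : V → Prop} {k : V} {Q Q' : List (EKind × V) → Prop} {x : V}
    {t : List (EKind × V)} (h : I G P k Q x t) (hx : x = k ∨ P x) (z : V) (e : EKind)
    (he : Edge G z e x) (hs : SufClosed Q) (hQQ : ∀ t, Q t → Q' t)
    (hQ : Q t → Q' ((e, x) :: t)) : ∃ t', I G P k Q' z t' := by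
  by_cases hz : z ∈ x :: t.map Prod.snd
  · obtain ⟨t', h'⟩ := h.cut hs z hz
    exact ⟨t', h'.mono (hQQ t')⟩
  · exact ⟨_, h.cons hx z e he hz hQ⟩

def AllK (e : EKind) (t : List (EKind × V)) : Prop := ∀ s ∈ t, s.1 = e

theorem AllK.suf (e : EKind) : SufClosed (AllK (V := V) e) :=
  fun _ _ h s hs => h s (List.mem_cons_of_mem _ hs)

theorem AllK.cons {e : EKind} {t : List (EKind × V)} (h : AllK e t) (x : V) :
    AllK e ((e, x) :: t) := by
  intro s hs
  rcases List.mem_cons.1 hs with rfl | hs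
  · rfl
  · exact h s hs

theorem Rch.start {R : V → V → Prop} {P : V → Prop} {x k : V} (h : Rch R P x k) :
    x = k ∨ P x := by
  rcases ReflTransGen.cases_head h with h | ⟨c, h, _⟩
  · exact Or.inl h
  · exact Or.inr h.2

theorem fwd_build (G : MixedGraph V) (P : V → Prop) (b k : V) (h : Rch G.dir P b k) :
    ∃ t, I G P k (AllK .fwd) b t := by
  induction h using ReflTransGen.head_induction_on with
  | refl => exact ⟨[], I.nil _ _ _ _ (by simp [AllK])⟩
  | head h1 h2 ih =>
    obtain ⟨t, ht⟩ := ih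
    exact ht.extend (Rch.start h2) _ .fwd ⟨h1.1, trivial⟩ (AllK.suf _) (fun _ h => h)
      (fun h => h.cons _)

theorem DD_trans {G : MixedGraph V} {P : V → Prop} {j k : V} (h : DD G P j k) :
    TransGen G.dir j k := by
  obtain ⟨c, h1, h2⟩ := h
  exact TransGen.head' h1 (rtg_mono (fun _ _ h => h.1) h2)

theorem acyc_trans (G : MixedGraph V) (h : G.Acyclic) (v : V) : ¬ TransGen G.dir v v := by
  intro hv
  obtain ⟨c, h1, h2⟩ := (TransGen.head'_iff).1 hv
  obtain ⟨t, ht⟩ := fwd_build G (fun _ => True) c v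
    (rtg_mono (fun _ _ h => ⟨h, trivial⟩) h2)
  refine h v ⟨⟨v, (.fwd, c) :: t⟩, ⟨⟨by simp, h1, ht.1⟩, rfl, ?_⟩, ht.2.2.2.2.cons c⟩
  exact (lastOf_cons v (EKind.fwd, c) t).trans ht.2.1

theorem right_iff (G : MixedGraph V) (hG : ∀ v, ¬ TransGen G.dir v v) (L : Set V) (j k : V) :
    (∃ w : MWalk V, MWalk.IsWalkFrom G w j k ∧ w.IsRightDirected ∧
        w.IsPath ∧ ∀ v ∈ w.interior, v ∉ L) ↔ DD G (fun x => x ∉ L) j k := by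
  constructor
  · rintro ⟨⟨x, t⟩, ⟨⟨hne, hv⟩, rfl, rfl⟩, hr, hp, hi⟩
    cases t with
    | nil => exact absurd rfl hne
    | cons s t =>
      obtain ⟨e, c⟩ := s
      have he : e = EKind.fwd := hr (e, c) (by simp)
      subst he
      refine ⟨c, hv.1, ?_⟩
      have := fwd_leg G (fun x => x ∉ L) c t hv.2 (fun s hs => hr s (List.mem_cons_of_mem _ hs)) hi
      rw [← lastOf_cons x (EKind.fwd, c)] at this
      exact this
  · intro h
    have hjk : j ≠ k := by rintro rfl; exact hG _ (DD_trans h)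
    obtain ⟨c, h1, h2⟩ := h
    obtain ⟨t, ht⟩ := fwd_build _ _ _ _ h2
    obtain ⟨t, ht⟩ := ht.extend (Rch.start h2) j .fwd ⟨h1, trivial⟩ (AllK.suf _) (fun _ h => h)
      (fun h => h.cons _)
    exact ⟨⟨j, t⟩, ⟨⟨ht.ne_nil hjk, ht.1⟩, rfl, ht.2.1⟩, ht.2.2.2.2, ht.2.2.1, ht.2.2.2.1⟩

theorem bwd_build (G : MixedGraph V) (P : V → Prop) (Q : List (EKind × V) → Prop)
    (hs : SufClosed Q) (k c j : V)
    (hQ : ∀ t y, (y ≠ k → t ≠ []) → P y → Q t → Q ((.bwd, y) :: t))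
    (hc : ∃ t, I G P k Q c t) (h : Rch G.dir P c j) :
    ∃ t, I G P k Q j t := by
  induction h with
  | refl => exact hc
  | tail h1 h2 ih =>
    obtain ⟨t, ht⟩ := ih
    exact ht.extend (Or.inr h2.2) _ .bwd ⟨h2.1, trivial⟩ hs (fun _ h => h)
      (hQ _ _ (fun h => ht.ne_nil h) h2.2)

theorem left_iff (G : MixedGraph V) (hG : ∀ v, ¬ TransGen G.dir v v) (L : Set V) (j k : V) :
    (∃ w : MWalk V, MWalk.IsWalkFrom G w j k ∧ w.IsLeftDirected ∧
        w.IsPath ∧ ∀ v ∈ w.interior, v ∉ L) ↔ DD G (fun x => x ∉ L) k j := by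
  constructor
  · rintro ⟨⟨x, t⟩, ⟨⟨hne, hv⟩, rfl, rfl⟩, hr, hp, hi⟩
    exact bwd_walk G (fun x => x ∉ L) x t hne hv hr hi
  · intro h
    have hjk : j ≠ k := by rintro rfl; exact hG _ (DD_trans h)
    obtain ⟨c, h1, h2⟩ := h
    have h0 := (I.nil G (fun x => x ∉ L) k (AllK .bwd) (by simp [AllK])).extend (Or.inl rfl) c .bwd
      ⟨h1, trivial⟩ (AllK.suf _) (fun _ h => h) (fun h => h.cons _)
    obtain ⟨t, ht⟩ := bwd_build G _ _ (AllK.suf _) k c j (fun t y _ _ h => h.cons _) h0 h2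
    exact ⟨⟨j, t⟩, ⟨⟨ht.ne_nil hjk, ht.1⟩, rfl, ht.2.1⟩, ht.2.2.2.2, ht.2.2.1, ht.2.2.2.1⟩

/-- backward steps, then at most one bidirected step, then forward steps, not ending backward. -/
def Arcish : List (EKind × V) → Prop
  | [] => True
  | (.fwd, _) :: t => AllK .fwd t
  | (.bidir, _) :: t => AllK .fwd t
  | (.bwd, _) :: t => t ≠ [] ∧ Arcish t

theorem Arcish.of_fwd {t : List (EKind × V)} (h : AllK .fwd t) : Arcish t := by
  cases t with
  | nil => trivial
  | cons s t =>
    obtain ⟨e, c⟩ := s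
    have he : e = EKind.fwd := h (e, c) (by simp)
    subst he
    exact AllK.suf _ _ _ h

theorem Arcish.suf : SufClosed (Arcish (V := V)) := by
  rintro ⟨e, x⟩ t h
  cases e
  · exact Arcish.of_fwd h
  · exact h.2
  · exact Arcish.of_fwd h

theorem Arcish.not_left {t : List (EKind × V)} (h : Arcish t) (hne : t ≠ []) : ¬ AllK .bwd t := by
  induction t with
  | nil => exact absurd rfl hne
  | cons s t ih =>
    intro hb
    obtain ⟨e, c⟩ := s
    have he : e = EKind.bwd := hb (e, c) (by simp)
    subst he
    exact ih h.2 h.1 (AllK.suf _ _ _ hb)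

theorem Arcish.isArc {t : List (EKind × V)} (h : Arcish t) (hne : t ≠ []) (j : V) :
    MWalk.IsArc ⟨j, t⟩ := by
  induction t with
  | nil => exact absurd rfl hne
  | cons s t ih =>
    obtain ⟨e, c⟩ := s
    cases e
    · exact Or.inr ⟨by simp, [], (.fwd, c) :: t, rfl, by simp, AllK.cons h c⟩
    · rcases ih h.2 h.1 with ⟨l, b, r, h1, h2, h3, h4⟩ | ⟨_, l, r, h1, h2, h3⟩
      · exact Or.inl ⟨(.bwd, c) :: l, b, r, congrArg _ h1, AllK.cons h2 c, h3, h4⟩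
      · exact Or.inr ⟨by simp, (.bwd, c) :: l, r, congrArg _ h1, AllK.cons h2 c, h3⟩
    · exact Or.inl ⟨[], (.bidir, c), t, rfl, by simp, rfl, h⟩

theorem mid_iff (G : MixedGraph V) (L : Set V) (j k : V) :
    (∃ w : MWalk V, MWalk.IsWalkFrom G w j k ∧ w.IsArc ∧
        ¬ w.IsRightDirected ∧ ¬ w.IsLeftDirected ∧ w.IsPath ∧
        ∀ v ∈ w.interior, v ∉ L) ↔ Mid G L j k := by
  constructor
  · rintro ⟨⟨x, t⟩, ⟨⟨hne, hv⟩, rfl, rfl⟩, ha, hr, hl, hp, hi⟩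
    change Mid G L x (lastOf x t)
    change t ≠ [] at hne
    change MWalk.Valid G x t at hv
    change (x :: t.map Prod.snd).Nodup at hp
    change ∀ v ∈ (t.map Prod.snd).dropLast, v ∉ L at hi
    have hP : ∀ v ∈ (t.map Prod.snd).dropLast, v ∉ L ∧ v ≠ x ∧ v ≠ lastOf x t :=
      fun v hv => ⟨hi v hv, mem_dropLast_ne x t hp v hv⟩
    have hxk : x ≠ lastOf x t := by
      intro e
      have := lastOf_mem x t hne
      rw [← e] at this
      exact (List.nodup_cons.1 hp).1 this
    refine ⟨hxk, ?_⟩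
    generalize hk : lastOf x t = k at *
    rcases ha with ⟨l, b, r, h1, h2, h3, h4⟩ | ⟨_, l, r, h1, h2, h3⟩
    · change t = l ++ b :: r at h1
      subst h1
      obtain ⟨e, b⟩ := b
      change e = _ at h3
      subst h3
      rw [valid_append] at hv
      rw [lastOf_append, lastOf_cons] at hk
      rw [List.map_append, List.dropLast_append_of_ne_nil (by simp)] at hP
      refine ⟨lastOf x l, b, Or.inr hv.2.1, ?_, ?_⟩
      · exact bwd_leg _ _ _ _ hv.1 h2 (fun v hv => hP v (List.mem_append_left _ hv))
      · have := fwd_leg G _ b r hv.2.2 h4 (fun v hv => hP v (List.mem_append_right _ hv))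
        rwa [hk] at this
    · change t = l ++ r at h1
      have hl0 : l ≠ [] := by
        rintro rfl
        apply hr
        change ∀ s ∈ t, _
        rw [h1]; exact h3
      have hr0 : r ≠ [] := by
        rintro rfl
        apply hl
        change ∀ s ∈ t, _
        rw [h1, List.append_nil]; exact h2
      subst h1
      rw [valid_append] at hv
      rw [lastOf_append] at hk
      rw [List.map_append, List.dropLast_append_of_ne_nil (by simpa using hr0)] at hP
      refine ⟨lastOf x l, lastOf x l, Or.inl rfl, ?_, ?_⟩
      · exact bwd_leg _ _ _ _ hv.1 h2 (fun v hv => hP v (List.mem_append_left _ hv))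
      · have := fwd_leg G (fun v => v ∉ L ∧ v ≠ x ∧ v ≠ k) (lastOf x l) r hv.2 h3 (by
          rw [List.dropLast_cons_of_ne_nil (by simpa using hr0)]
          intro v hv
          rcases List.mem_cons.1 hv with rfl | hv
          · exact hP _ (List.mem_append_left _ (lastOf_mem _ _ hl0))
          · exact hP v (List.mem_append_right _ hv))
        rwa [hk] at this
  · rintro ⟨hjk, a, b, hab, ha, hb⟩
    obtain ⟨r, hr⟩ := fwd_build _ _ _ _ hb
    have fin : ∀ t, I G (fun x => x ∉ L ∧ x ≠ j ∧ x ≠ k) k Arcish j t → ¬ AllK .fwd t →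
        ∃ w : MWalk V, MWalk.IsWalkFrom G w j k ∧ w.IsArc ∧
        ¬ w.IsRightDirected ∧ ¬ w.IsLeftDirected ∧ w.IsPath ∧
        ∀ v ∈ w.interior, v ∉ L := by
      intro t ht hf
      have hne := ht.ne_nil hjk
      exact ⟨⟨j, t⟩, ⟨⟨hne, ht.1⟩, rfl, ht.2.1⟩, ht.2.2.2.2.isArc hne j, hf,
        ht.2.2.2.2.not_left hne, ht.2.2.1, fun v hv => (ht.2.2.2.1 v hv).1⟩
    rcases ReflTransGen.cases_tail ha with rfl | ⟨y, hy, hyj⟩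
    · rcases hab with rfl | hab
      · rcases Rch.start hb with h | h
        · exact absurd h hjk
        · exact absurd rfl h.2.1
      · refine fin _ (hr.cons (Rch.start hb) j .bidir ⟨hab, trivial⟩ ?_ (fun h => h)) ?_
        · intro h
          rcases hr.verts (Rch.start hb) _ h with h | h
          · exact hjk h
          · exact h.2.1 rfl
        · intro h
          have := h _ List.mem_cons_self
          cases this
    · have h0 : ∃ t, I G (fun x => x ∉ L ∧ x ≠ j ∧ x ≠ k) k Arcish a t := by
        rcases hab with rfl | hab
        · exact ⟨r, hr.mono Arcish.of_fwd⟩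
        · exact hr.extend (Rch.start hb) a .bidir ⟨hab, trivial⟩ (AllK.suf _)
            (fun _ => Arcish.of_fwd) (fun h => h)
      obtain ⟨t, ht⟩ := bwd_build G _ _ Arcish.suf k a y
        (fun t y h1 h2 h3 => ⟨h1 h2.2.2, h3⟩) h0 hy
      refine fin _ (ht.cons (Or.inr hyj.2) j .bwd ⟨hyj.1, trivial⟩ ?_
        (fun h => ⟨ht.ne_nil hyj.2.2.2, h⟩)) ?_
      · intro h
        rcases ht.verts (Or.inr hyj.2) _ h with h | h
        · exact hjk h
        · exact h.2.1 rfl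
      · intro h
        have := h _ List.mem_cons_self
        cases this

theorem marg_dir (G : MixedGraph V) (hG : ∀ v, ¬ TransGen G.dir v v) (T : Set V) (x y : V) :
    (G.margStar T).dir x y ↔ x ∈ T ∧ y ∈ T ∧ DD G (fun v => v ∉ T) x y := by
  rw [← right_iff G hG]; rfl

theorem marg_bi (G : MixedGraph V) (T : Set V) (x y : V) :
    (G.margStar T).bi x y ↔ x ∈ T ∧ y ∈ T ∧ Mid G T x y := by
  rw [← mid_iff G]; rfl

theorem marg_acyc (G : MixedGraph V) (hG : ∀ v, ¬ TransGen G.dir v v) (T : Set V) (v : V) :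
    ¬ TransGen (G.margStar T).dir v v := by
  intro h
  refine hG v ?_
  have : TransGen (TransGen G.dir) v v :=
    tg_mono (fun x y h => DD_trans ((marg_dir G hG T x y).1 h).2.2) h
  rwa [transGen_eq_self] at this

theorem Rch.monoP {R : V → V → Prop} {P P' : V → Prop} (h : ∀ v, P v → P' v) {x y : V}
    (hr : Rch R P x y) : Rch R P' x y :=
  rtg_mono (fun _ _ h' => ⟨h'.1, h _ h'.2⟩) hr

theorem rch_down (G : MixedGraph V) (hG : ∀ v, ¬ TransGen G.dir v v) (T : Set V) (P : V → Prop)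
    (hP : ∀ v, v ∉ T → P v) (x y : V) (h : Rch (G.margStar T).dir P x y) : Rch G.dir P x y := by
  induction h with
  | refl => exact ReflTransGen.refl
  | tail h1 h2 ih =>
    obtain ⟨_, _, c, h3, h4⟩ := (marg_dir G hG T _ _).1 h2.1
    exact ReflTransGen.trans ih (ReflTransGen.head ⟨h3, h2.2⟩ (Rch.monoP hP h4))

theorem rch_up (G : MixedGraph V) (hG : ∀ v, ¬ TransGen G.dir v v) (T : Set V) (P : V → Prop)
    (x y : V) (hy : y ∈ T) (h : Rch G.dir P x y) :
    ∃ t ∈ T, Rch G.dir (fun v => v ∉ T) x t ∧ Rch (G.margStar T).dir P t y := by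
  induction h using ReflTransGen.head_induction_on with
  | refl => exact ⟨y, hy, ReflTransGen.refl, ReflTransGen.refl⟩
  | @head x z h1 h2 ih =>
    obtain ⟨t, ht, h3, h4⟩ := ih
    by_cases hx : x ∈ T
    · exact ⟨x, hx, ReflTransGen.refl,
        ReflTransGen.head ⟨(marg_dir G hG T _ _).2 ⟨hx, ht, z, h1.1, h3⟩, h1.2⟩ h4⟩
    · exact ⟨t, ht, ReflTransGen.head ⟨h1.1, hx⟩ h3, h4⟩

theorem DD_marg (G : MixedGraph V) (hG : ∀ v, ¬ TransGen G.dir v v) (T L : Set V) (hLT : L ⊆ T)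
    (j k : V) (hj : j ∈ T) (hk : k ∈ T) :
    DD (G.margStar T) (fun v => v ∉ L) j k ↔ DD G (fun v => v ∉ L) j k := by
  have hP : ∀ v, v ∉ T → v ∉ L := fun v hv h => hv (hLT h)
  constructor
  · rintro ⟨c, h1, h2⟩
    obtain ⟨_, _, d, h3, h4⟩ := (marg_dir G hG T _ _).1 h1
    exact ⟨d, h3, ReflTransGen.trans (Rch.monoP hP h4) (rch_down G hG T _ hP _ _ h2)⟩
  · rintro ⟨c, h1, h2⟩
    obtain ⟨t, ht, h3, h4⟩ := rch_up G hG T _ _ _ hk h2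
    exact ⟨t, (marg_dir G hG T _ _).2 ⟨hj, ht, c, h1, h3⟩, h4⟩

theorem Mid_marg (G : MixedGraph V) (hG : ∀ v, ¬ TransGen G.dir v v) (T L : Set V) (hLT : L ⊆ T)
    (j k : V) (hj : j ∈ T) (hk : k ∈ T) :
    Mid (G.margStar T) L j k ↔ Mid G L j k := by
  have hP : ∀ v, v ∉ T → v ∉ L ∧ v ≠ j ∧ v ≠ k := fun v hv =>
    ⟨fun h => hv (hLT h), fun h => hv (h ▸ hj), fun h => hv (h ▸ hk)⟩
  constructor
  · rintro ⟨hjk, a, b, hab, ha, hb⟩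
    have ha' := rch_down G hG T _ hP _ _ ha
    have hb' := rch_down G hG T _ hP _ _ hb
    rcases hab with rfl | hab
    · exact ⟨hjk, a, a, Or.inl rfl, ha', hb'⟩
    · obtain ⟨_, _, _, c, d, hcd, hc, hd⟩ := (marg_bi G T _ _).1 hab
      exact ⟨hjk, c, d, hcd, ReflTransGen.trans (Rch.monoP (fun v h => hP v h.1) hc) ha',
        ReflTransGen.trans (Rch.monoP (fun v h => hP v h.1) hd) hb'⟩
  · rintro ⟨hjk, a, b, hab, ha, hb⟩
    obtain ⟨t, ht, h1, h2⟩ := rch_up G hG T _ _ _ hj ha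
    obtain ⟨u, hu, h3, h4⟩ := rch_up G hG T _ _ _ hk hb
    by_cases htu : t = u
    · exact ⟨hjk, t, u, Or.inl htu, h2, h4⟩
    · have hQ : ∀ v, v ∉ T → v ∉ T ∧ v ≠ t ∧ v ≠ u := fun v hv =>
        ⟨hv, fun h => hv (h ▸ ht), fun h => hv (h ▸ hu)⟩
      exact ⟨hjk, t, u, Or.inr ((marg_bi G T _ _).2 ⟨ht, hu, htu, a, b, hab,
        Rch.monoP hQ h1, Rch.monoP hQ h3⟩), h2, h4⟩

theorem arc_split (G : MixedGraph V) (L : Set V) (j k : V) :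
    (∃ w : MWalk V, MWalk.IsWalkFrom G w j k ∧ w.IsArc ∧
        w.IsPath ∧ ∀ v ∈ w.interior, v ∉ L) ↔
    ((∃ w : MWalk V, MWalk.IsWalkFrom G w j k ∧ w.IsRightDirected ∧
        w.IsPath ∧ ∀ v ∈ w.interior, v ∉ L) ∨
     (∃ w : MWalk V, MWalk.IsWalkFrom G w j k ∧ w.IsLeftDirected ∧
        w.IsPath ∧ ∀ v ∈ w.interior, v ∉ L) ∨
     (∃ w : MWalk V, MWalk.IsWalkFrom G w j k ∧ w.IsArc ∧
        ¬ w.IsRightDirected ∧ ¬ w.IsLeftDirected ∧ w.IsPath ∧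
        ∀ v ∈ w.interior, v ∉ L)) := by
  constructor
  · rintro ⟨w, h1, h2, h3, h4⟩
    by_cases hr : w.IsRightDirected
    · exact Or.inl ⟨w, h1, hr, h3, h4⟩
    by_cases hl : w.IsLeftDirected
    · exact Or.inr (Or.inl ⟨w, h1, hl, h3, h4⟩)
    exact Or.inr (Or.inr ⟨w, h1, h2, hr, hl, h3, h4⟩)
  · rintro (⟨w, h1, h2, h3, h4⟩ | ⟨w, h1, h2, h3, h4⟩ | ⟨w, h1, h2, _, _, h3, h4⟩)
    · exact ⟨w, h1, Or.inr ⟨h1.1.1, [], w.tail, rfl, by simp, h2⟩, h3, h4⟩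
    · exact ⟨w, h1, Or.inr ⟨h1.1.1, w.tail, [], by simp, h2, by simp⟩, h3, h4⟩
    · exact ⟨w, h1, h2, h3, h4⟩

end MSP

/-- ADMG-marginalization preserves unblocked right-directed paths,
left-directed paths, bi-arrowheaded arc paths, and arc paths. -/
theorem margStar_preserves_paths {V : Type*} (G : MixedGraph V) (hsymm : G.BiSymm)
    (hacy : G.Acyclic) (hnoloop : ∀ v, ¬ G.bi v v)
    (T L : Set V) (hLT : L ⊆ T) (j k : V) (hj : j ∈ T) (hk : k ∈ T) :
    ((∃ w : MWalk V, MWalk.IsWalkFrom (G.margStar T) w j k ∧ w.IsRightDirected ∧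
        w.IsPath ∧ ∀ v ∈ w.interior, v ∉ L) ↔
      (∃ w : MWalk V, MWalk.IsWalkFrom G w j k ∧ w.IsRightDirected ∧
        w.IsPath ∧ ∀ v ∈ w.interior, v ∉ L)) ∧
    ((∃ w : MWalk V, MWalk.IsWalkFrom (G.margStar T) w j k ∧ w.IsLeftDirected ∧
        w.IsPath ∧ ∀ v ∈ w.interior, v ∉ L) ↔
      (∃ w : MWalk V, MWalk.IsWalkFrom G w j k ∧ w.IsLeftDirected ∧
        w.IsPath ∧ ∀ v ∈ w.interior, v ∉ L)) ∧
    ((∃ w : MWalk V, MWalk.IsWalkFrom (G.margStar T) w j k ∧ w.IsArc ∧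
        ¬ w.IsRightDirected ∧ ¬ w.IsLeftDirected ∧ w.IsPath ∧
        ∀ v ∈ w.interior, v ∉ L) ↔
      (∃ w : MWalk V, MWalk.IsWalkFrom G w j k ∧ w.IsArc ∧
        ¬ w.IsRightDirected ∧ ¬ w.IsLeftDirected ∧ w.IsPath ∧
        ∀ v ∈ w.interior, v ∉ L)) ∧
    ((∃ w : MWalk V, MWalk.IsWalkFrom (G.margStar T) w j k ∧ w.IsArc ∧
        w.IsPath ∧ ∀ v ∈ w.interior, v ∉ L) ↔
      (∃ w : MWalk V, MWalk.IsWalkFrom G w j k ∧ w.IsArc ∧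
        w.IsPath ∧ ∀ v ∈ w.interior, v ∉ L)) := by
  have hG := MSP.acyc_trans G hacy
  have hM := MSP.marg_acyc G hG T
  refine ⟨?_, ?_, ?_, ?_⟩
  · rw [MSP.right_iff _ hM, MSP.right_iff _ hG, MSP.DD_marg G hG T L hLT j k hj hk]
  · rw [MSP.left_iff _ hM, MSP.left_iff _ hG, MSP.DD_marg G hG T L hLT k j hk hj]
  · rw [MSP.mid_iff, MSP.mid_iff, MSP.Mid_marg G hG T L hLT j k hj hk]
  · rw [MSP.arc_split, MSP.arc_split, MSP.right_iff _ hM, MSP.right_iff _ hG,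
      MSP.left_iff _ hM, MSP.left_iff _ hG, MSP.mid_iff, MSP.mid_iff,
      MSP.DD_marg G hG T L hLT j k hj hk, MSP.DD_marg G hG T L hLT k j hk hj,
      MSP.Mid_marg G hG T L hLT j k hj hk]
end

section
/- Let G be a directed mixed graph and {j}, {k}, L pairwise disjoint subsets of V with j, k single vertices. If G is canonical, then the following are equivalent: (i) j tconn k | L; (ii) j mconn k | L; (iii) some path from j to k is not ancestrally blocked by L. If moreover G is canonically directed, then (i), (ii), (iii) are also equivalent to: (iv) j dconn k | L; (v) some path from j to k using only directed edges is not ancestrally blocked by L. -/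
namespace TS
open MWalk MixedGraph

variable {V : Type*}

/-- One valid step. -/
def St (G : MixedGraph V) (a : V) (s : EKind × V) : Prop :=
  match s.1 with
  | EKind.fwd => G.dir a s.2
  | EKind.bwd => G.dir s.2 a
  | EKind.bidir => G.bi a s.2

/-- Valid list of steps from `a` to `k`. -/
def Wk (G : MixedGraph V) : V → List (EKind × V) → V → Prop
  | a, [], k => a = k
  | a, s :: r, k => St G a s ∧ Wk G s.2 r k

/-- Local unblockedness. -/
def RR (C L : Set V) (s t : EKind × V) : Prop :=
  (arrowAtEnd s.1 = true ∧ arrowAtStart t.1 = true ∧ s.2 ∈ C) ∨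
  (¬ (arrowAtEnd s.1 = true ∧ arrowAtStart t.1 = true) ∧ s.2 ∉ L)

/-- Ancestors of `L`. -/
def An (G : MixedGraph V) (L : Set V) : Set V := {v | v ∈ L ∨ ∃ l ∈ L, G.RDConn v l}

theorem wk_iff (G : MixedGraph V) (l : List (EKind × V)) (a k : V) :
    Wk G a l k ↔ Valid G a l ∧ (MWalk.mk a l).last = k := by
  induction l generalizing a with
  | nil => simp [Wk, Valid, MWalk.last]
  | cons s r ih =>
    simp only [Wk, ih, Valid, St, MWalk.last, List.map_cons, List.getLastD_cons, and_assoc]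

theorem wk_append (G : MixedGraph V) (l r : List (EKind × V)) (a k : V) :
    Wk G a (l ++ r) k ↔ ∃ m, Wk G a l m ∧ Wk G m r k := by
  induction l generalizing a with
  | nil => simp [Wk]
  | cons s t ih => simp only [List.cons_append, Wk, ih]; grind

theorem walkFrom_iff (G : MixedGraph V) (w : MWalk V) (j k : V) :
    IsWalkFrom G w j k ↔ w.head = j ∧ w.tail ≠ [] ∧ Wk G j w.tail k := by
  obtain ⟨a, l⟩ := w
  simp only [IsWalkFrom, IsWalk, wk_iff]
  constructor
  · rintro ⟨⟨h1, h2⟩, rfl, h4⟩; exact ⟨rfl, h1, h2, h4⟩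
  · rintro ⟨rfl, h1, h2, h4⟩; exact ⟨⟨h1, h2⟩, rfl, h4⟩

theorem collider_iff (w : MWalk V) (i : ℕ) (h : i + 1 < w.tail.length) :
    w.ColliderAt i ↔ (arrowAtEnd (w.tail[i]).1 = true ∧ arrowAtStart (w.tail[i+1]).1 = true) := by
  have h1 : w.tail[i]? = some w.tail[i] := List.getElem?_eq_getElem (by omega)
  have h2 : w.tail[i+1]? = some w.tail[i+1] := List.getElem?_eq_getElem h
  simp [ColliderAt, h1, h2]

theorem blocked_iff (w : MWalk V) (L : Set V) :
    ¬ w.Blocked L ↔ w.tail.IsChain (RR L L) := by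
  rw [List.isChain_iff_getElem]
  constructor
  · intro h i hi
    by_contra hc
    refine h ⟨i, (w.tail[i]).2, hi, ?_, ?_⟩
    · rw [List.getElem?_eq_getElem (by omega)]; rfl
    · rw [collider_iff w i hi]; unfold RR at hc; tauto
  · rintro h ⟨i, v, hi, hv, hc⟩
    have := h i hi
    rw [List.getElem?_eq_getElem (by omega)] at hv
    simp only [Option.map_some, Option.some.injEq] at hv
    rw [collider_iff w i hi] at hc
    unfold RR at this
    rw [hv] at this
    tauto

theorem ancBlocked_iff (G : MixedGraph V) (w : MWalk V) (L : Set V) :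
    ¬ G.AncBlocked w L ↔ w.tail.IsChain (RR (An G L) L) := by
  rw [List.isChain_iff_getElem]
  constructor
  · intro h i hi
    by_contra hc
    refine h ⟨i, (w.tail[i]).2, hi, ?_, ?_⟩
    · rw [List.getElem?_eq_getElem (by omega)]; rfl
    · rw [collider_iff w i hi]; simp only [RR, An, Set.mem_ofPred_eq] at hc
      generalize (∃ l ∈ L, G.RDConn (w.tail[i]).2 l) = P at hc ⊢
      tauto
  · rintro h ⟨i, v, hi, hv, hc⟩
    have := h i hi
    rw [List.getElem?_eq_getElem (by omega)] at hv
    simp only [Option.map_some, Option.some.injEq] at hv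
    rw [collider_iff w i hi] at hc
    simp only [RR, An, Set.mem_ofPred_eq] at this
    rw [hv] at this
    generalize (∃ l ∈ L, G.RDConn v l) = P at this hc
    tauto

theorem an_step (G : MixedGraph V) (L : Set V) (v x : V) (h : G.dir v x) (hx : x ∈ An G L) :
    v ∈ An G L := by
  right
  rcases hx with hx | ⟨l, hl, ⟨b, t⟩, hw, hr⟩
  · refine ⟨x, hx, ⟨v, [(.fwd, x)]⟩, ?_, ?_⟩
    · rw [walkFrom_iff]; simp [Wk, St, h]
    · simp [IsRightDirected]
  · rw [walkFrom_iff] at hw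
    refine ⟨l, hl, ⟨v, (.fwd, x) :: t⟩, ?_, ?_⟩
    · rw [walkFrom_iff]; exact ⟨rfl, by simp, h, hw.2.2⟩
    · simpa [IsRightDirected] using hr

/-- A forward run that ends with a backward step meets a collider. -/
theorem an_of_run (G : MixedGraph V) (L : Set V) (l : List (EKind × V)) (v k : V)
    (x t : EKind × V) (hw : Wk G v (x :: l ++ [t]) k)
    (hc : (x :: l ++ [t]).IsChain (RR (An G L) L))
    (hx : arrowAtStart x.1 = false) (ht : arrowAtEnd t.1 = false) : v ∈ An G L := by
  induction l generalizing v x with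
  | nil =>
    obtain ⟨e, x⟩ := x
    cases e <;> simp_all [arrowAtStart]
    obtain ⟨e, t⟩ := t
    cases e <;> simp_all [arrowAtEnd]
    simp [RR, arrowAtEnd, arrowAtStart] at hc
    exact an_step G L v x hw.1 hc
  | cons y l ih =>
    obtain ⟨e, x⟩ := x
    cases e <;> simp [arrowAtStart] at hx
    simp only [List.cons_append, List.isChain_cons_cons] at hc
    refine an_step G L v x hw.1 ?_
    by_cases hy : arrowAtStart y.1 = true
    · have := hc.1
      simp [RR, arrowAtEnd, hy] at this
      exact this
    · exact ih x y hw.2 hc.2 (by simpa using hy)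

theorem short_key (G : MixedGraph V) (L : Set V) (l : List (EKind × V)) (k : V)
    (s t u : EKind × V) (hst : s.2 = t.2) (hw : Wk G s.2 (l ++ [t]) k)
    (hc : (s :: l ++ [t]).IsChain (RR (An G L) L)) (hu : RR (An G L) L t u) :
    RR (An G L) L s u := by
  obtain ⟨x, hx⟩ : ∃ x, x ∈ (l ++ [t]).head? ∧ RR (An G L) L s x := by
    cases l with
    | nil => exact ⟨t, by simp, by simpa using hc⟩
    | cons y l => exact ⟨y, by simp, by simp at hc; exact hc.1⟩
  by_cases hL : s.2 ∈ L
  · have h1 := hx.2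
    have : s.2 ∈ An G L := Or.inl hL
    have hL2 : t.2 ∈ L := hst ▸ hL
    simp only [RR] at *
    tauto
  · by_cases hcol : arrowAtEnd s.1 = true ∧ arrowAtStart u.1 = true
    · left
      refine ⟨hcol.1, hcol.2, ?_⟩
      by_cases ht : arrowAtEnd t.1 = true
      · rcases hu with hu | hu
        · rw [hst]; exact hu.2.2
        · exact absurd ⟨ht, hcol.2⟩ hu.1
      · have ht' : arrowAtEnd t.1 = false := by simpa using ht
        by_cases hxs : arrowAtStart x.1 = true
        · rcases hx.2 with h | h
          · exact h.2.2
          · exact absurd ⟨hcol.1, hxs⟩ h.1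
        · have hxs' : arrowAtStart x.1 = false := by simpa using hxs
          cases l with
          | nil =>
            simp at hx
            obtain ⟨rfl, _⟩ := hx
            obtain ⟨e, t⟩ := t
            cases e <;> simp_all [arrowAtStart, arrowAtEnd]
          | cons y l =>
            simp at hx
            obtain ⟨rfl, _⟩ := hx
            exact an_of_run G L l s.2 k y t hw (by simp at hc; exact hc.2) hxs' ht'
    · exact Or.inr ⟨hcol, hL⟩

theorem dup_split {α β : Type*} (f : α → β) (l : List α) (h : ¬ (l.map f).Nodup) :
    ∃ l1 s l2 t l3, l = l1 ++ s :: (l2 ++ t :: l3) ∧ f s = f t := by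
  induction l with
  | nil => simp at h
  | cons a l ih =>
    by_cases ha : f a ∈ l.map f
    · obtain ⟨t, ht, hf⟩ := List.mem_map.1 ha
      obtain ⟨l2, l3, rfl⟩ := List.append_of_mem ht
      exact ⟨[], a, l2, t, l3, rfl, hf.symm⟩
    · obtain ⟨l1, s, l2, t, l3, rfl, hf⟩ := ih (by
        intro h2; exact h (by rw [List.map_cons, List.nodup_cons]; exact ⟨ha, h2⟩))
      exact ⟨a :: l1, s, l2, t, l3, rfl, hf⟩

theorem exists_path (G : MixedGraph V) (L : Set V) (j k : V) (n : ℕ) :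
    ∀ l : List (EKind × V), l.length ≤ n → Wk G j l k → l.IsChain (RR (An G L) L) →
    ∃ l' : List (EKind × V), Wk G j l' k ∧ l'.IsChain (RR (An G L) L) ∧
      (j :: l'.map Prod.snd).Nodup := by
  induction n with
  | zero =>
    intro l hl hw hc
    have : l = [] := by simpa using hl
    subst this
    exact ⟨[], hw, hc, by simp⟩
  | succ n ih =>
    intro l hl hw hc
    by_cases hj : j ∈ l.map Prod.snd
    · obtain ⟨s, hs, rfl⟩ := List.mem_map.1 hj
      obtain ⟨l1, l2, rfl⟩ := List.append_of_mem hs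
      rw [wk_append] at hw
      obtain ⟨m, h1, h2⟩ := hw
      refine ih l2 (by simp at hl; omega) h2.2 ?_
      exact (List.isChain_append.1 hc).2.1.tail
    by_cases hn : (l.map Prod.snd).Nodup
    · exact ⟨l, hw, hc, List.nodup_cons.2 ⟨hj, hn⟩⟩
    obtain ⟨l1, s, l2, t, l3, rfl, hst⟩ := dup_split _ _ hn
    rw [wk_append] at hw
    obtain ⟨m, h1, h2, h3⟩ := hw
    have h3' : Wk G s.2 ((l2 ++ [t]) ++ l3) k := by simpa using h3
    rw [wk_append] at h3'
    obtain ⟨m', h4, h5⟩ := h3'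
    have hm' : m' = s.2 := by
      rw [wk_append] at h4
      obtain ⟨_, _, h6⟩ := h4
      rw [hst]; exact h6.2.symm
    subst hm'
    refine ih (l1 ++ s :: l3) (by simp at hl ⊢; omega) ?_ ?_
    · rw [wk_append]; exact ⟨m, h1, h2, h5⟩
    · rw [List.isChain_split] at hc ⊢
      refine ⟨hc.1, ?_⟩
      have hc2 : ((s :: l2) ++ t :: l3).IsChain (RR (An G L) L) := hc.2
      rw [List.isChain_split] at hc2
      rw [List.isChain_cons]
      have h8 := hc2.2
      rw [List.isChain_cons] at h8
      exact ⟨fun u hu => short_key G L l2 _ s t u hst h4 hc2.1 (h8.1 u hu), h8.2⟩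

/-- Detour from `v` to `L` and back. -/
theorem detour (G : MixedGraph V) (L : Set V) (r : List (EKind × V)) (l : V) (hl : l ∈ L) :
    ∀ v, v ∉ L → Wk G v r l → (∀ s ∈ r, s.1 = EKind.fwd) →
    ∃ (x : V) (d : List (EKind × V)), Wk G v ((EKind.fwd, x) :: d ++ [(EKind.bwd, v)]) v ∧
      ((EKind.fwd, x) :: d ++ [(EKind.bwd, v)]).IsChain (RR L L) ∧ ∀ s ∈ d, s.1 ≠ EKind.bidir := by
  induction r with
  | nil => intro v hv hw; exact absurd ((show v = l from hw) ▸ hl) hv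
  | cons s r ih =>
    intro v hv hw hf
    obtain ⟨e, x⟩ := s
    obtain rfl : e = .fwd := hf (e, x) (by simp)
    have hvx : G.dir v x := hw.1
    by_cases hx : x ∈ L
    · exact ⟨x, [], by simp [Wk, St, hvx], by simp [RR, arrowAtEnd, arrowAtStart, hx], by simp⟩
    · obtain ⟨y, d, h1, h2, h3⟩ := ih x hx hw.2 (fun s hs => hf s (by simp [hs]))
      refine ⟨x, (.fwd, y) :: d ++ [(EKind.bwd, x)], ?_, ?_, ?_⟩
      · refine ⟨hvx, ?_⟩
        rw [List.append_eq, wk_append]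
        exact ⟨x, h1, by simp [Wk, St, hvx]⟩
      · have h4 : ((EKind.fwd, y) :: d ++ [(EKind.bwd, x)] ++ [(EKind.bwd, v)]).IsChain (RR L L) := by
          rw [List.isChain_append]
          refine ⟨h2, by simp, ?_⟩
          intro y hy
          rw [List.getLast?_append] at hy
          simp at hy
          subst hy
          simp [RR, arrowAtEnd, hx]
        have : (EKind.fwd, x) :: ((EKind.fwd, y) :: d ++ [(EKind.bwd, x)]) ++ [(EKind.bwd, v)]
          = (EKind.fwd, x) :: ((EKind.fwd, y) :: d ++ [(EKind.bwd, x)] ++ [(EKind.bwd, v)]) := by simp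
        rw [this, List.isChain_cons]
        refine ⟨?_, h4⟩
        simp [RR, arrowAtStart, hx]
      · intro s hs
        simp at hs
        rcases hs with rfl | hs | rfl
        · simp
        · exact h3 _ hs
        · simp

theorem undo (G : MixedGraph V) (L : Set V) (k : V) (r : List (EKind × V)) :
    ∀ (a : V) (s : EKind × V), Wk G a (s :: r) k → (s :: r).IsChain (RR (An G L) L) →
    ∃ r', Wk G a (s :: r') k ∧ (s :: r').IsChain (RR L L) ∧
      ((∀ x ∈ s :: r, x.1 ≠ EKind.bidir) → ∀ x ∈ s :: r', x.1 ≠ EKind.bidir) := by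
  induction r with
  | nil => intro a s hw _; exact ⟨[], hw, by simp, fun h => h⟩
  | cons t r ih =>
    intro a s hw hc
    rw [List.isChain_cons_cons] at hc
    obtain ⟨r', h1, h2, h3⟩ := ih s.2 t hw.2 hc.2
    by_cases hR : RR L L s t
    · refine ⟨t :: r', ⟨hw.1, h1⟩, by simp [hR, h2], ?_⟩
      intro h x hx
      rcases List.mem_cons.1 hx with rfl | hx
      · exact h _ (by simp)
      · exact h3 (fun y hy => h y (List.mem_cons_of_mem _ hy)) x hx
    · have hc1 := hc.1
      have : s.2 ∉ L ∧ ∃ l ∈ L, G.RDConn s.2 l := by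
        simp only [RR, An, Set.mem_ofPred_eq] at hR hc1
        tauto
      obtain ⟨hs, l, hl, w, hww, hwr⟩ := this
      rw [walkFrom_iff] at hww
      obtain ⟨x, d, d1, d2, d3⟩ := detour G L w.tail l hl s.2 hs hww.2.2 hwr
      refine ⟨((.fwd, x) :: d ++ [(EKind.bwd, s.2)]) ++ t :: r', ⟨hw.1, ?_⟩, ?_, ?_⟩
      · rw [wk_append]; exact ⟨_, d1, h1⟩
      · rw [List.isChain_cons]
        constructor
        · simp [RR, arrowAtStart, hs]
        · rw [List.isChain_append]
          refine ⟨d2, h2, ?_⟩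
          intro y hy
          rw [List.getLast?_append] at hy
          simp at hy
          subst hy
          simp [RR, arrowAtEnd, hs]
      · intro h y hy
        simp only [List.mem_cons, List.mem_append, List.cons_append] at hy
        rcases hy with rfl | rfl | (hy | hy) | hy
        · exact h _ (by simp)
        · simp
        · exact d3 _ hy
        · simp at hy; subst hy; simp
        · exact h3 (fun y hy => h y (List.mem_cons_of_mem _ hy)) y (by simpa using hy)

theorem rr_mono (G : MixedGraph V) (L : Set V) {s t : EKind × V} (h : RR L L s t) :
    RR (An G L) L s t := by
  rcases h with h | h
  · exact Or.inl ⟨h.1, h.2.1, Or.inl h.2.2⟩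
  · exact Or.inr h

/-- Right leg in progress. -/
inductive RLeg (G : MixedGraph V) (L : Set V) (k : V) : V → Prop
  | done : RLeg G L k k
  | coll {a : V} (ha : a ∈ L) (h : G.TConn L a k) : RLeg G L k a
  | step {a x : V} (ha : a ∉ L) (h : G.dir a x) (hx : RLeg G L k x) : RLeg G L k a

theorem rleg_list (G : MixedGraph V) (L : Set V) (k b : V) (h : RLeg G L k b) :
    ∃ r m, Wk G b r m ∧ (∀ s ∈ r, s.1 = EKind.fwd) ∧ (∀ e, ((e, b) :: r).IsChain (RR L L)) ∧
      (m = k ∨ (m ∈ L ∧ G.TConn L m k)) := by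
  induction h with
  | done => exact ⟨[], k, rfl, by simp, by simp, Or.inl rfl⟩
  | @coll a ha h => exact ⟨[], a, rfl, by simp, by simp, Or.inr ⟨ha, h⟩⟩
  | @step a x ha h hx ih =>
    obtain ⟨r, m, h1, h2, h3, h4⟩ := ih
    refine ⟨(.fwd, x) :: r, m, ⟨h, h1⟩, ?_, ?_, h4⟩
    · simpa using h2
    · intro e
      rw [List.isChain_cons_cons]
      exact ⟨by simp [RR, arrowAtStart, ha], h3 _⟩

theorem tconn_bi (G : MixedGraph V) (L : Set V) (k a b : V) (hab : G.bi a b)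
    (h : RLeg G L k b) : G.TConn L a k := by
  obtain ⟨r, m, h1, h2, h3, h4⟩ := rleg_list G L k b h
  have hw : IsWalkFrom G ⟨a, (.bidir, b) :: r⟩ a m := by
    rw [walkFrom_iff]; exact ⟨rfl, by simp, hab, h1⟩
  have ht : IsTrek (⟨a, (.bidir, b) :: r⟩ : MWalk V) :=
    ⟨[], (.bidir, b), r, rfl, by simp, rfl, h2⟩
  have hb : ¬ Blocked (⟨a, (.bidir, b) :: r⟩ : MWalk V) L := by
    rw [blocked_iff]; exact h3 _
  rcases h4 with rfl | ⟨hm, hT⟩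
  · exact .single _ hw ht hb
  · exact .cons _ hw ht hb hm hT

theorem trek_bwd (G : MixedGraph V) (L : Set V) (m a x : V) (hax : G.dir x a) (hx : x ∉ L)
    (w : MWalk V) (hw : IsWalkFrom G w x m) (ht : w.IsTrek) (hb : ¬ w.Blocked L) :
    ∃ w' : MWalk V, IsWalkFrom G w' a m ∧ w'.IsTrek ∧ ¬ w'.Blocked L := by
  refine ⟨⟨a, (.bwd, x) :: w.tail⟩, ?_, ?_, ?_⟩
  · rw [walkFrom_iff] at hw ⊢
    exact ⟨rfl, by simp, hax, hw.2.2⟩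
  · obtain ⟨l, b, r, h1, h2, h3, h4⟩ := ht
    exact ⟨(.bwd, x) :: l, b, r, by simp [h1], by simpa using h2, h3, h4⟩
  · rw [blocked_iff] at hb ⊢
    rw [List.isChain_cons]
    exact ⟨by simp [RR, arrowAtEnd, hx], hb⟩

theorem tconn_bwd (G : MixedGraph V) (L : Set V) (k a x : V) (hax : G.dir x a) (hx : x ∉ L)
    (h : G.TConn L x k) : G.TConn L a k := by
  cases h with
  | single w hw ht hb =>
    obtain ⟨w', h1, h2, h3⟩ := trek_bwd G L _ a x hax hx w hw ht hb
    exact .single w' h1 h2 h3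
  | cons w hw ht hb hm h =>
    obtain ⟨w', h1, h2, h3⟩ := trek_bwd G L _ a x hax hx w hw ht hb
    exact .cons w' h1 h2 h3 hm h

theorem m_to_t (G : MixedGraph V) (hcan : G.Canonical) (L : Set V) (k : V) (hk : k ∉ L)
    (l : List (EKind × V)) : ∀ a, Wk G a l k → l.IsChain (RR L L) →
    ((∀ s ∈ l.head?, arrowAtStart s.1 = true ∨ a ∉ L) → G.TConn L a k) ∧
    ((∀ s ∈ l.head?, (arrowAtStart s.1 = true ∧ a ∈ L) ∨ (arrowAtStart s.1 = false ∧ a ∉ L)) →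
      RLeg G L k a) := by
  induction l with
  | nil =>
    intro a hw _
    obtain rfl : a = k := hw
    exact ⟨fun _ => tconn_bi G L a a a (hcan a) .done, fun _ => .done⟩
  | cons s r ih =>
    intro a hw hc
    obtain ⟨e, x⟩ := s
    rw [List.isChain_cons] at hc
    obtain ⟨hA, hB⟩ := ih x hw.2 hc.2
    have hx := hc.1
    cases e with
    | fwd =>
      have hxB : RLeg G L k x := hB (fun s hs => by
        have := hx s hs
        simp only [RR, arrowAtEnd] at this
        cases h : arrowAtStart s.1 <;> simp_all)
      have key : a ∉ L → RLeg G L k a := fun ha => .step ha hw.1 hxB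
      constructor
      · intro h
        have ha : a ∉ L := by simpa [arrowAtStart] using h
        exact tconn_bi G L k a a (hcan a) (key ha)
      · intro h
        exact key (by simpa [arrowAtStart] using h)
    | bidir =>
      have hxB : RLeg G L k x := hB (fun s hs => by
        have := hx s hs
        simp only [RR, arrowAtEnd] at this
        cases h : arrowAtStart s.1 <;> simp_all)
      have hT := tconn_bi G L k a x hw.1 hxB
      exact ⟨fun _ => hT, fun h => .coll (by simpa [arrowAtStart] using h) hT⟩
    | bwd =>
      have hxL : x ∉ L := by
        cases r with
        | nil => exact (show x = k from hw.2) ▸ hk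
        | cons t r =>
          have := hx t (by simp)
          simpa [RR, arrowAtEnd] using this
      have hT := tconn_bwd G L k a x hw.1 hxL (hA fun _ _ => Or.inr hxL)
      exact ⟨fun _ => hT, fun h => .coll (by simpa [arrowAtStart] using h) hT⟩

theorem trek_ends (w : MWalk V) (h : w.IsTrek) :
    (∀ s ∈ w.tail.head?, arrowAtStart s.1 = true) ∧
    (∀ s ∈ w.tail.getLast?, arrowAtEnd s.1 = true) := by
  obtain ⟨l, b, r, h1, h2, h3, h4⟩ := h
  rw [h1]
  constructor
  · intro s hs
    cases l with
    | nil => simp at hs; subst hs; rw [h3]; rfl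
    | cons y l => simp at hs; subst hs; rw [h2 y (by simp)]; rfl
  · intro s hs
    rw [List.getLast?_append_cons] at hs
    have : s ∈ b :: r := List.mem_of_getLast? hs
    rcases List.mem_cons.1 this with rfl | h
    · rw [h3]; rfl
    · rw [h4 s h]; rfl

theorem t_to_m (G : MixedGraph V) (L : Set V) (j k : V) (h : G.TConn L j k) :
    ∃ l, l ≠ [] ∧ Wk G j l k ∧ l.IsChain (RR L L) ∧
      ∀ s ∈ l.head?, arrowAtStart s.1 = true := by
  induction h with
  | single w hw ht hb =>
    rw [walkFrom_iff] at hw; rw [blocked_iff] at hb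
    exact ⟨w.tail, hw.2.1, hw.2.2, hb, (trek_ends w ht).1⟩
  | @cons j m k w hw ht hb hm h ih =>
    obtain ⟨l, h1, h2, h3, h4⟩ := ih
    rw [walkFrom_iff] at hw; rw [blocked_iff] at hb
    refine ⟨w.tail ++ l, by simp [h1], ?_, ?_, ?_⟩
    · rw [wk_append]; exact ⟨m, hw.2.2, h2⟩
    · rw [List.isChain_append]
      refine ⟨hb, h3, fun x hx y hy => Or.inl ⟨(trek_ends w ht).2 x hx, h4 y hy, ?_⟩⟩
      have hx2 := List.getLast?_eq_some_iff.1 hx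
      obtain ⟨ys, hys⟩ := hx2
      have hwk := hw.2.2
      rw [hys, wk_append] at hwk
      obtain ⟨_, _, h6⟩ := hwk
      rw [show x.2 = m from h6.2]; exact hm
    · rw [List.head?_append_of_ne_nil _ hw.2.1]; exact (trek_ends w ht).1

theorem path_directed (G : MixedGraph V) (hG : G.CanonicallyDirected) (k : V)
    (l : List (EKind × V)) : ∀ a, Wk G a l k → (a :: l.map Prod.snd).Nodup →
    ∀ s ∈ l, s.1 ≠ EKind.bidir := by
  induction l with
  | nil => simp
  | cons t r ih =>
    intro a hw hn s hs
    rw [List.map_cons, List.nodup_cons] at hn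
    rcases List.mem_cons.1 hs with rfl | hs
    · intro he
      have h1 := hw.1
      simp only [St, he] at h1
      exact hn.1 (by rw [(hG _ _).1 h1]; simp)
    · exact ih t.2 hw.2 hn.2 s hs

theorem ne_nil {G : MixedGraph V} {j k : V} (h : j ≠ k) {l : List (EKind × V)}
    (hw : Wk G j l k) : l ≠ [] := by
  rintro rfl; exact h hw

end TS

/-- In canonical graphs, t-connection, m-connection, and the existence of a
path not ancestrally blocked all coincide; in canonically directed graphs these
further coincide with d-connection and the existence of a directed-edge path
not ancestrally blocked. -/
theorem tsep_simplify {V : Type*} (G : MixedGraph V) (hsymm : G.BiSymm)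
    (hcan : G.Canonical) (j k : V) (L : Set V)
    (hjk : j ≠ k) (hjL : j ∉ L) (hkL : k ∉ L) :
    [G.TConn L j k, G.MConn j k L,
     (∃ w : MWalk V, MWalk.IsWalkFrom G w j k ∧ w.IsPath ∧ ¬ G.AncBlocked w L)].TFAE ∧
    (G.CanonicallyDirected →
      [G.TConn L j k, G.MConn j k L,
       (∃ w : MWalk V, MWalk.IsWalkFrom G w j k ∧ w.IsPath ∧ ¬ G.AncBlocked w L),
       G.DConn j k L,
       (∃ w : MWalk V, MWalk.IsWalkFrom G w j k ∧ w.IsPath ∧ w.DirectedOnly ∧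
          ¬ G.AncBlocked w L)].TFAE) := by
  have h12 : G.TConn L j k → G.MConn j k L := by
    intro h
    obtain ⟨l, h1, h2, h3, _⟩ := TS.t_to_m G L j k h
    exact ⟨⟨j, l⟩, (TS.walkFrom_iff _ _ _ _).2 ⟨rfl, h1, h2⟩, (TS.blocked_iff _ _).2 h3⟩
  have h21 : G.MConn j k L → G.TConn L j k := by
    rintro ⟨w, hw, hb⟩
    rw [TS.walkFrom_iff] at hw
    rw [TS.blocked_iff] at hb
    exact (TS.m_to_t G hcan L k hkL w.tail j hw.2.2 hb).1 (fun _ _ => Or.inr hjL)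
  have h23 : G.MConn j k L →
      ∃ w : MWalk V, MWalk.IsWalkFrom G w j k ∧ w.IsPath ∧ ¬ G.AncBlocked w L := by
    rintro ⟨w, hw, hb⟩
    rw [TS.walkFrom_iff] at hw
    rw [TS.blocked_iff] at hb
    obtain ⟨l, h1, h2, h3⟩ := TS.exists_path G L j k _ w.tail le_rfl hw.2.2
      (hb.imp fun _ _ h => TS.rr_mono G L h)
    exact ⟨⟨j, l⟩, (TS.walkFrom_iff _ _ _ _).2 ⟨rfl, TS.ne_nil hjk h1, h1⟩, h3,
      (TS.ancBlocked_iff _ _ _).2 h2⟩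
  have hun : ∀ w : MWalk V, MWalk.IsWalkFrom G w j k → ¬ G.AncBlocked w L →
      ∃ w' : MWalk V, MWalk.IsWalkFrom G w' j k ∧ (w.DirectedOnly → w'.DirectedOnly) ∧
        ¬ w'.Blocked L := by
    rintro ⟨a, l⟩ hw hb
    rw [TS.walkFrom_iff] at hw
    rw [TS.ancBlocked_iff] at hb
    cases l with
    | nil => exact absurd rfl hw.2.1
    | cons s r =>
      obtain ⟨r', h1, h2, h3⟩ := TS.undo G L k r j s hw.2.2 hb
      exact ⟨⟨j, s :: r'⟩, (TS.walkFrom_iff _ _ _ _).2 ⟨rfl, by simp, h1⟩, h3,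
        (TS.blocked_iff _ _).2 h2⟩
  have h32 : (∃ w : MWalk V, MWalk.IsWalkFrom G w j k ∧ w.IsPath ∧ ¬ G.AncBlocked w L) →
      G.MConn j k L := by
    rintro ⟨w, hw, _, hb⟩
    obtain ⟨w', h1, _, h3⟩ := hun w hw hb
    exact ⟨w', h1, h3⟩
  refine ⟨?_, fun hG => ?_⟩
  · tfae_have 1 → 2 := h12
    tfae_have 2 → 1 := h21
    tfae_have 2 → 3 := h23
    tfae_have 3 → 2 := h32
    tfae_finish
  · tfae_have 1 → 2 := h12
    tfae_have 2 → 1 := h21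
    tfae_have 2 → 3 := h23
    tfae_have 3 → 5 := by
      rintro ⟨⟨a, l⟩, hw, hp, hb⟩
      refine ⟨⟨a, l⟩, hw, hp, ?_, hb⟩
      rw [TS.walkFrom_iff] at hw
      obtain ⟨rfl, h1, h2⟩ := hw
      exact TS.path_directed G hG k l a h2 hp
    tfae_have 5 → 4 := by
      rintro ⟨w, hw, _, hd, hb⟩
      obtain ⟨w', h1, h2, h3⟩ := hun w hw hb
      exact ⟨w', h1, h2 hd, h3⟩
    tfae_have 4 → 2 := by
      rintro ⟨w, hw, _, hb⟩
      exact ⟨w, hw, hb⟩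
    tfae_finish
end

section
/- Let G be a canonical directed mixed graph and {j}, {k}, L pairwise disjoint subsets of V with j, k single vertices, and let Ṽ = {j, k} ∪ L. Then j mconn k | L in G if and only if there is a collider-connected walk from j to k in marg_Ṽ(G). -/
namespace MWalk
variable {V : Type*}

def EE (G : MixedGraph V) : EKind → V → V → Prop
  | .fwd, a, b => G.dir a b
  | .bwd, a, b => G.dir b a
  | .bidir, a, b => G.bi a b

def Col (e e' : EKind) : Prop := arrowAtEnd e = true ∧ arrowAtStart e' = true

inductive W (E : EKind → V → V → Prop) (P : EKind → V → EKind → Prop) :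
    EKind → V → EKind → V → Prop
  | single {e a b} : E e a b → W E P e a e b
  | cons {e a b e' f c} : E e a b → P e b e' → W E P e' b f c → W E P e a f c

section
variable {E E' : EKind → V → V → Prop} {P P' : EKind → V → EKind → Prop}

theorem W.append {e a f b g h c} (h1 : W E P e a f b) (hP : P f b g) (h2 : W E P g b h c) :
    W E P e a h c := by
  induction h1 with
  | single h => exact .cons h hP h2
  | cons h hp _ ih => exact .cons h hp (ih hP h2)

theorem W.mono (hP : ∀ e v e', P e v e' → P' e v e') {e a f b} (h : W E P e a f b) :
    W E P' e a f b := by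
  induction h with
  | single h => exact .single h
  | cons h hp _ ih => exact .cons h (hP _ _ _ hp) ih

def rv : EKind → EKind
  | .fwd => .bwd
  | .bwd => .fwd
  | .bidir => .bidir

theorem W.rev (hE : ∀ e a b, E e a b → E' (rv e) b a)
    (hP : ∀ e v e', P e v e' → P' (rv e') v (rv e)) {e a f b} (h : W E P e a f b) :
    W E' P' (rv f) b (rv e) a := by
  induction h with
  | single h => exact .single (hE _ _ _ h)
  | cons h hp _ ih => exact ih.append (hP _ _ _ hp) (.single (hE _ _ _ h))

theorem W.cutEnd {e a f k} (h : W E P e a f k) :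
    ∃ f', W E (fun e v e' => P e v e' ∧ v ≠ k) e a f' k := by
  induction h with
  | single h => exact ⟨_, .single h⟩
  | @cons e a b e' f c h hp _ ih =>
    by_cases hb : b = c
    · subst hb; exact ⟨_, .single h⟩
    · obtain ⟨f', h'⟩ := ih
      exact ⟨f', .cons h ⟨hp, hb⟩ h'⟩

theorem W.cutStart (j : V) {e a f k} (h : W E P e a f k) :
    W E (fun e v e' => P e v e' ∧ v ≠ j) e a f k ∨
      ∃ e', W E (fun e v e' => P e v e' ∧ v ≠ j) e' j f k := by
  induction h with
  | single h => exact .inl (.single h)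
  | @cons e a b e' f c h hp _ ih =>
    rcases ih with ih | ih
    · by_cases hb : b = j
      · subst hb; exact .inr ⟨_, ih⟩
      · exact .inl (.cons h ⟨hp, hb⟩ ih)
    · exact .inr ih

theorem W.cut {e f j k} (h : W E P e j f k) :
    ∃ e f, W E (fun e v e' => P e v e' ∧ v ≠ k ∧ v ≠ j) e j f k := by
  obtain ⟨f', h'⟩ := h.cutEnd
  have : ∃ e', W E (fun e v e' => (P e v e' ∧ v ≠ k) ∧ v ≠ j) e' j f' k := by
    rcases h'.cutStart j with h | h
    · exact ⟨_, h⟩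
    · exact h
  obtain ⟨e', h''⟩ := this
  exact ⟨e', f', h''.mono (fun _ _ _ h => ⟨h.1.1, h.1.2, h.2⟩)⟩
end

def LW (G : MixedGraph V) (a : V) (t : List (EKind × V)) (b : V) : Prop :=
  t ≠ [] ∧ Valid G a t ∧ (t.map Prod.snd).getLastD a = b

def Chain (P : EKind → V → EKind → Prop) (l : List (EKind × V)) : Prop :=
  ∀ (i : ℕ) (s t : EKind × V), l[i]? = some s → l[i+1]? = some t → P s.1 s.2 t.1

theorem valid_cons {G : MixedGraph V} {a s l} :
    Valid G a (s :: l) ↔ EE G s.1 a s.2 ∧ Valid G s.2 l := by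
  rcases s with ⟨e, b⟩
  cases e <;> simp [Valid, EE]

theorem LW.single {G : MixedGraph V} {a e b c} :
    LW G a [(e, b)] c ↔ EE G e a b ∧ b = c := by
  cases e <;> simp [LW, EE, Valid]

theorem LW.cons {G : MixedGraph V} {a s t l c} :
    LW G a (s :: t :: l) c ↔ EE G s.1 a s.2 ∧ LW G s.2 (t :: l) c := by
  simp only [LW, valid_cons, ne_eq, List.cons_ne_nil, not_false_eq_true, true_and, List.map_cons]
  simp only [List.getLastD_cons, and_assoc]

theorem isWalkFrom_iff {G : MixedGraph V} {w : MWalk V} {a b} :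
    IsWalkFrom G w a b ↔ w.head = a ∧ LW G a w.tail b := by
  constructor
  · rintro ⟨⟨h1, h2⟩, rfl, h4⟩
    exact ⟨rfl, h1, h2, h4⟩
  · rintro ⟨rfl, h1, h2, h3⟩
    exact ⟨⟨h1, h2⟩, rfl, h3⟩

theorem chain_cons {P : EKind → V → EKind → Prop} {s t l} :
    Chain P (s :: t :: l) ↔ P s.1 s.2 t.1 ∧ Chain P (t :: l) := by
  constructor
  · intro h
    exact ⟨h 0 s t rfl rfl, fun i s' t' h1 h2 => h (i+1) s' t' (by simpa using h1) (by simpa using h2)⟩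
  · rintro ⟨h1, h2⟩ i s' t' hs ht
    cases i with
    | zero => simp at hs ht; subst hs ht; exact h1
    | succ i => exact h2 i s' t' (by simpa using hs) (by simpa using ht)

theorem W_of_list {G : MixedGraph V} {P : EKind → V → EKind → Prop} {b} (l : List (EKind × V)) :
    ∀ a s, LW G a (s :: l) b → Chain P (s :: l) → ∃ f, W (EE G) P s.1 a f b := by
  induction l with
  | nil =>
    rintro a ⟨e, c⟩ h _
    obtain ⟨h0, rfl⟩ := LW.single.1 h
    exact ⟨_, .single h0⟩
  | cons t l ih =>
    intro a s h hc
    rw [LW.cons] at h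
    rw [chain_cons] at hc
    obtain ⟨f, hf⟩ := ih _ _ h.2 hc.2
    exact ⟨f, .cons h.1 hc.1 hf⟩

theorem list_of_W {G : MixedGraph V} {P : EKind → V → EKind → Prop} {e a f b}
    (h : W (EE G) P e a f b) :
    ∃ s l, s.1 = e ∧ LW G a (s :: l) b ∧ Chain P (s :: l) := by
  induction h with
  | @single e a b h =>
    refine ⟨(e, b), [], rfl, LW.single.2 ⟨h, rfl⟩, ?_⟩
    intro i s t _ ht
    simp at ht
  | @cons e a b e' f c h hp _ ih =>
    obtain ⟨s, l, rfl, h1, h2⟩ := ih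
    exact ⟨(e, b), s :: l, rfl, LW.cons.2 ⟨h, h1⟩, chain_cons.2 ⟨hp, h2⟩⟩

theorem W_iff {G : MixedGraph V} {P : EKind → V → EKind → Prop} {a b} :
    (∃ w : MWalk V, IsWalkFrom G w a b ∧ Chain P w.tail) ↔ ∃ e f, W (EE G) P e a f b := by
  constructor
  · rintro ⟨⟨a', t⟩, h, hc⟩
    obtain ⟨rfl, h⟩ := isWalkFrom_iff.1 h
    cases t with
    | nil => exact absurd rfl h.1
    | cons s l => exact ⟨_, W_of_list l _ s h hc⟩
  · rintro ⟨e, f, h⟩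
    obtain ⟨s, l, -, h1, h2⟩ := list_of_W h
    exact ⟨⟨a, s :: l⟩, isWalkFrom_iff.2 ⟨rfl, h1⟩, h2⟩

theorem colliderAt_iff {w : MWalk V} {i s t} (hs : w.tail[i]? = some s)
    (ht : w.tail[i+1]? = some t) : w.ColliderAt i ↔ Col s.1 t.1 := by
  simp [ColliderAt, Col, hs, ht]

theorem not_blocked_iff {w : MWalk V} {L : Set V} :
    ¬ w.Blocked L ↔ Chain (fun e v e' => Col e e' ↔ v ∈ L) w.tail := by
  constructor
  · intro h i s t hs ht
    by_contra hc
    refine h ⟨i, s.2, ?_, by simp [hs], ?_⟩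
    · exact (List.getElem?_eq_some_iff.1 ht).1
    · rw [colliderAt_iff hs ht]; tauto
  · rintro h ⟨i, v, hi, hv, hc⟩
    have hs : w.tail[i]? = some w.tail[i] := List.getElem?_eq_getElem (by omega)
    have ht : w.tail[i+1]? = some w.tail[i+1] := List.getElem?_eq_getElem hi
    have := h i _ _ hs ht
    rw [colliderAt_iff hs ht] at hc
    simp only [hs, Option.map_some, Option.some.injEq] at hv
    rw [hv] at this
    tauto

theorem cc_iff {w : MWalk V} :
    w.IsColliderConnected ↔ Chain (fun e _ e' => Col e e') w.tail := by
  constructor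
  · intro h i s t hs ht
    exact (colliderAt_iff hs ht).1 (h i (List.getElem?_eq_some_iff.1 ht).1)
  · intro h i hi
    have hs : w.tail[i]? = some w.tail[i] := List.getElem?_eq_getElem (by omega)
    have ht : w.tail[i+1]? = some w.tail[i+1] := List.getElem?_eq_getElem hi
    exact (colliderAt_iff hs ht).2 (h i _ _ hs ht)

/-- right-directed chain predicate -/
def PF (T : Set V) (e : EKind) (v : V) (e' : EKind) : Prop := e = .fwd ∧ e' = .fwd ∧ v ∉ T
def PB (T : Set V) (e : EKind) (v : V) (e' : EKind) : Prop := e = .bwd ∧ e' = .bwd ∧ v ∉ T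
def PN (T : Set V) (e : EKind) (v : V) (e' : EKind) : Prop := ¬ Col e e' ∧ v ∉ T

/-- list-level statements -/
def RL (G : MixedGraph V) (T : Set V) (a b : V) : Prop :=
  ∃ t, LW G a t b ∧ (∀ s ∈ t, s.1 = EKind.fwd) ∧ ∀ v ∈ (t.map Prod.snd).dropLast, v ∉ T
def TL (G : MixedGraph V) (T : Set V) (a b : V) : Prop :=
  ∃ t, LW G a t b ∧ (∃ (l : List (EKind × V)) (b : EKind × V) (r : List (EKind × V)),
    t = l ++ b :: r ∧ (∀ s ∈ l, s.1 = EKind.bwd) ∧ b.1 = EKind.bidir ∧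
      (∀ s ∈ r, s.1 = EKind.fwd)) ∧ ∀ v ∈ (t.map Prod.snd).dropLast, v ∉ T

theorem marg_dir {G : MixedGraph V} {T : Set V} {a b} :
    (G.marg T).dir a b ↔ a ∈ T ∧ b ∈ T ∧ RL G T a b := by
  constructor
  · rintro ⟨h1, h2, ⟨h, t⟩, h3, h4, h5⟩
    obtain ⟨rfl, h3⟩ := isWalkFrom_iff.1 h3
    exact ⟨h1, h2, t, h3, h4, h5⟩
  · rintro ⟨h1, h2, t, h3, h4, h5⟩
    exact ⟨h1, h2, ⟨a, t⟩, isWalkFrom_iff.2 ⟨rfl, h3⟩, h4, h5⟩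

theorem marg_bi {G : MixedGraph V} {T : Set V} {a b} :
    (G.marg T).bi a b ↔ a ∈ T ∧ b ∈ T ∧ TL G T a b := by
  constructor
  · rintro ⟨h1, h2, ⟨h, t⟩, h3, h4, h5⟩
    obtain ⟨rfl, h3⟩ := isWalkFrom_iff.1 h3
    exact ⟨h1, h2, t, h3, h4, h5⟩
  · rintro ⟨h1, h2, t, h3, h4, h5⟩
    exact ⟨h1, h2, ⟨a, t⟩, isWalkFrom_iff.2 ⟨rfl, h3⟩, h4, h5⟩

theorem RL_single {G : MixedGraph V} {T : Set V} {a b} (h : G.dir a b) : RL G T a b :=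
  ⟨[(.fwd, b)], LW.single.2 ⟨h, rfl⟩, by simp, by simp⟩

theorem RL_cons {G : MixedGraph V} {T : Set V} {a b c} (h : G.dir a b) (hb : b ∉ T)
    (h2 : RL G T b c) : RL G T a c := by
  obtain ⟨t, h3, h4, h5⟩ := h2
  cases t with
  | nil => exact absurd rfl h3.1
  | cons s l =>
    refine ⟨(.fwd, b) :: s :: l, LW.cons.2 ⟨h, h3⟩, ?_, ?_⟩
    · intro x hx
      rcases List.mem_cons.1 hx with rfl | hx
      · rfl
      · exact h4 _ hx
    · intro v hv
      simp only [List.map_cons, List.dropLast_cons_cons, List.mem_cons] at hv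
      rcases hv with rfl | hv
      · exact hb
      · exact h5 _ hv

theorem TL_single {G : MixedGraph V} {T : Set V} {a b} (h : G.bi a b) : TL G T a b :=
  ⟨[(.bidir, b)], LW.single.2 ⟨h, rfl⟩, ⟨[], _, [], rfl, by simp, rfl, by simp⟩, by simp⟩

theorem TL_bi {G : MixedGraph V} {T : Set V} {a b c} (h : G.bi a b) (hb : b ∉ T)
    (h2 : RL G T b c) : TL G T a c := by
  obtain ⟨t, h3, h4, h5⟩ := h2
  cases t with
  | nil => exact absurd rfl h3.1
  | cons s l =>
    refine ⟨(.bidir, b) :: s :: l, LW.cons.2 ⟨h, h3⟩, ⟨[], _, _, rfl, by simp, rfl, h4⟩, ?_⟩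
    · intro v hv
      simp only [List.map_cons, List.dropLast_cons_cons, List.mem_cons] at hv
      rcases hv with rfl | hv
      · exact hb
      · exact h5 _ hv

theorem TL_bwd {G : MixedGraph V} {T : Set V} {a b c} (h : G.dir b a) (hb : b ∉ T)
    (h2 : TL G T b c) : TL G T a c := by
  obtain ⟨t, h3, ⟨l', x, r, h6, h7, h8, h9⟩, h5⟩ := h2
  cases t with
  | nil => exact absurd rfl h3.1
  | cons s l =>
    refine ⟨(.bwd, b) :: s :: l, LW.cons.2 ⟨h, h3⟩,
      ⟨(.bwd, b) :: l', x, r, by rw [h6]; rfl, ?_, h8, h9⟩, ?_⟩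
    · intro x hx
      rcases List.mem_cons.1 hx with rfl | hx
      · rfl
      · exact h7 _ hx
    · intro v hv
      simp only [List.map_cons, List.dropLast_cons_cons, List.mem_cons] at hv
      rcases hv with rfl | hv
      · exact hb
      · exact h5 _ hv

/-- parse right directed -/
theorem RL_W {G : MixedGraph V} {T : Set V} {b} : ∀ (t : List (EKind × V)) (a), LW G a t b →
    (∀ s ∈ t, s.1 = EKind.fwd) → (∀ v ∈ (t.map Prod.snd).dropLast, v ∉ T) →
    W (EE G) (PF T) .fwd a .fwd b := by
  intro t
  induction t with
  | nil => intro a h; exact absurd rfl h.1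
  | cons s l ih =>
    rintro a h h1 h2
    rcases s with ⟨e, c⟩
    have he : e = .fwd := h1 _ (List.mem_cons_self ..)
    subst he
    cases l with
    | nil =>
      obtain ⟨h0, rfl⟩ := LW.single.1 h
      exact .single h0
    | cons s l =>
      rw [LW.cons] at h
      simp only [List.map_cons, List.dropLast_cons_cons, List.mem_cons] at h2
      refine .cons h.1 ⟨rfl, rfl, h2 _ (.inl rfl)⟩ (ih _ h.2 ?_ ?_)
      · intro x hx; exact h1 x (List.mem_cons_of_mem _ hx)
      · intro v hv; exact h2 v (.inr hv)

theorem PF_PN {T : Set V} (e : EKind) (v : V) (e' : EKind) (h : PF T e v e') : PN T e v e' := by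
  obtain ⟨rfl, rfl, h⟩ := h
  exact ⟨by simp [Col, arrowAtStart], h⟩

theorem TL_W {G : MixedGraph V} {T : Set V} {b} (x : EKind × V) (r : List (EKind × V))
    (hx : x.1 = .bidir) (hr : ∀ s ∈ r, s.1 = EKind.fwd) : ∀ (l : List (EKind × V)) (a),
    LW G a (l ++ x :: r) b → (∀ s ∈ l, s.1 = EKind.bwd) →
    (∀ v ∈ ((l ++ x :: r).map Prod.snd).dropLast, v ∉ T) →
    ∃ e f, arrowAtStart e = true ∧ arrowAtEnd f = true ∧ W (EE G) (PN T) e a f b := by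
  intro l
  rcases x with ⟨x, y⟩
  simp only at hx
  subst hx
  induction l with
  | nil =>
    intro a h _ h2
    simp only [List.nil_append] at h h2
    cases r with
    | nil =>
      obtain ⟨h0, rfl⟩ := LW.single.1 h
      exact ⟨.bidir, .bidir, rfl, rfl, .single h0⟩
    | cons s l =>
      rw [LW.cons] at h
      simp only [List.map_cons, List.dropLast_cons_cons, List.mem_cons] at h2
      refine ⟨.bidir, .fwd, rfl, rfl, .cons h.1 ⟨by simp [Col, arrowAtStart], h2 _ (.inl rfl)⟩
        ((RL_W (T := T) _ _ h.2 hr ?_).mono PF_PN)⟩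
      intro v hv; exact h2 v (.inr hv)
  | cons s l ih =>
    intro a h h1 h2
    rcases s with ⟨e, c⟩
    have he : e = .bwd := h1 _ (List.mem_cons_self ..)
    subst he
    obtain ⟨s', l', hl⟩ : ∃ s' l', l ++ (EKind.bidir, y) :: r = s' :: l' := by
      cases l <;> simp
    rw [List.cons_append, hl] at h h2
    rw [LW.cons] at h
    simp only [List.map_cons, List.dropLast_cons_cons, List.mem_cons] at h2
    obtain ⟨e, f, h3, h4, h5⟩ := ih c (by rw [hl]; exact h.2)
      (fun x hx => h1 x (List.mem_cons_of_mem _ hx))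
      (by rw [hl]; intro v hv; exact h2 v (.inr hv))
    exact ⟨.bwd, f, rfl, h4, .cons h.1 ⟨by simp [Col, arrowAtEnd], h2 _ (.inl rfl)⟩ h5⟩

theorem EE_rv {G : MixedGraph V} (hs : G.BiSymm) (e : EKind) (a b : V) (h : EE G e a b) :
    EE G (rv e) b a := by
  cases e
  · exact h
  · exact h
  · exact hs _ _ h

/-- marginal edge to a segment -/
theorem seg_of_edge {G : MixedGraph V} (hs : G.BiSymm) {T : Set V} {e a b}
    (h : EE (G.marg T) e a b) : ∃ e' f', arrowAtStart e' = arrowAtStart e ∧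
      arrowAtEnd f' = arrowAtEnd e ∧ W (EE G) (PN T) e' a f' b ∧ a ∈ T ∧ b ∈ T := by
  cases e with
  | fwd =>
    obtain ⟨ha, hb, t, h1, h2, h3⟩ := marg_dir.1 h
    exact ⟨_, _, rfl, rfl, (RL_W t a h1 h2 h3).mono PF_PN, ha, hb⟩
  | bwd =>
    obtain ⟨ha, hb, t, h1, h2, h3⟩ := marg_dir.1 h
    refine ⟨_, _, ?_, ?_, (RL_W t b h1 h2 h3).rev (EE_rv hs) ?_, hb, ha⟩
    · rfl
    · rfl
    · rintro e v e' ⟨rfl, rfl, hv⟩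
      exact ⟨by simp [Col, arrowAtEnd, rv], hv⟩
  | bidir =>
    obtain ⟨ha, hb, t, h1, ⟨l, x, r, rfl, h4, h5, h6⟩, h3⟩ := marg_bi.1 h
    obtain ⟨e, f, h7, h8, h9⟩ := TL_W x r h5 h6 l a h1 h4 h3
    exact ⟨e, f, h7, h8, h9, ha, hb⟩

theorem RL_of_PF {G : MixedGraph V} {T : Set V} {e a f b} (h : W (EE G) (PF T) e a f b)
    (he : e = .fwd) : RL G T a b := by
  induction h with
  | single h => subst he; exact RL_single h
  | cons h hp _ ih => subst he; exact RL_cons h hp.2.2 (ih hp.2.1)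

theorem fwd_seg {G : MixedGraph V} {T : Set V} {e a f b} (h : W (EE G) (PN T) e a f b)
    (he : e = .fwd) : RL G T a b ∧ f = .fwd := by
  induction h with
  | single h => subst he; exact ⟨RL_single h, rfl⟩
  | @cons e a b e' f c h hp _ ih =>
    subst he
    have he' : e' = .fwd := by
      have := hp.1
      cases e' <;> simp_all [Col, arrowAtEnd, arrowAtStart]
    exact ⟨RL_cons h hp.2 (ih he').1, (ih he').2⟩

theorem bi_seg {G : MixedGraph V} {T : Set V} {e a f b} (h : W (EE G) (PN T) e a f b)
    (he : e = .bidir) : TL G T a b ∧ arrowAtEnd f = true := by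
  cases h with
  | single h => subst he; exact ⟨TL_single h, rfl⟩
  | @cons _ _ b e' _ _ h hp h2 =>
    subst he
    have he' : e' = .fwd := by
      have := hp.1
      cases e' <;> simp_all [Col, arrowAtEnd, arrowAtStart]
    obtain ⟨h3, rfl⟩ := fwd_seg h2 he'
    exact ⟨TL_bi h hp.2 h3, rfl⟩

theorem bwd_seg {G : MixedGraph V} (hcan : G.Canonical) {T : Set V} {e a f b}
    (h : W (EE G) (PN T) e a f b) (he : e = .bwd) :
    (TL G T a b ∧ arrowAtEnd f = true) ∨ (f = .bwd ∧ W (EE G) (PB T) .bwd a .bwd b) := by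
  induction h with
  | single h => subst he; exact .inr ⟨rfl, .single h⟩
  | @cons e a b e' f c h hp h2 ih =>
    subst he
    cases e' with
    | fwd =>
      obtain ⟨h3, rfl⟩ := fwd_seg h2 rfl
      exact .inl ⟨TL_bwd h hp.2 (TL_bi (hcan b) hp.2 h3), rfl⟩
    | bidir =>
      obtain ⟨h3, h4⟩ := bi_seg h2 rfl
      exact .inl ⟨TL_bwd h hp.2 h3, h4⟩
    | bwd =>
      rcases ih rfl with ih | ih
      · exact .inl ⟨TL_bwd h hp.2 ih.1, ih.2⟩
      · exact .inr ⟨ih.1, .cons h ⟨rfl, rfl, hp.2⟩ ih.2⟩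

theorem edge_of_seg {G : MixedGraph V} (hs : G.BiSymm) (hcan : G.Canonical) {T : Set V} {e a f b}
    (h : W (EE G) (PN T) e a f b) (ha : a ∈ T) (hb : b ∈ T) :
    ∃ e', arrowAtStart e' = arrowAtStart e ∧ arrowAtEnd e' = arrowAtEnd f ∧
      EE (G.marg T) e' a b := by
  cases e with
  | fwd =>
    obtain ⟨h3, rfl⟩ := fwd_seg h rfl
    exact ⟨.fwd, rfl, rfl, marg_dir.2 ⟨ha, hb, h3⟩⟩
  | bidir =>
    obtain ⟨h3, h4⟩ := bi_seg h rfl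
    exact ⟨.bidir, rfl, h4.symm, marg_bi.2 ⟨ha, hb, h3⟩⟩
  | bwd =>
    rcases bwd_seg hcan h rfl with ⟨h3, h4⟩ | ⟨rfl, h3⟩
    · exact ⟨.bidir, rfl, h4.symm, marg_bi.2 ⟨ha, hb, h3⟩⟩
    · refine ⟨.bwd, rfl, rfl, marg_dir.2 ⟨hb, ha, ?_⟩⟩
      refine RL_of_PF (h3.rev (P' := PF T) (EE_rv hs) ?_) rfl
      rintro e v e' ⟨rfl, rfl, hv⟩
      exact ⟨rfl, rfl, hv⟩

/-- forward direction -/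
theorem to_marg {G : MixedGraph V} (hs : G.BiSymm) (hcan : G.Canonical) {j k : V} {L : Set V}
    {e a f c}
    (h : W (EE G) (fun e v e' => (Col e e' ↔ v ∈ L) ∧ v ≠ k ∧ v ≠ j) e a f c)
    (hk : c ∈ ({j, k} ∪ L : Set V)) :
    ∃ f1 m, W (EE G) (PN ({j, k} ∪ L)) e a f1 m ∧ m ∈ ({j, k} ∪ L : Set V) ∧
      (m = c ∨ ∃ e2 f2, Col f1 e2 ∧
        W (EE (G.marg ({j, k} ∪ L))) (fun e _ e' => Col e e') e2 m f2 c) := by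
  induction h with
  | @single e a b h => exact ⟨_, _, .single h, hk, .inl rfl⟩
  | @cons e a b e' f c h hp _ ih =>
    obtain ⟨f1, m, h1, h2, h3⟩ := ih hk
    by_cases hb : b ∈ L
    · have hbT : b ∈ ({j, k} ∪ L : Set V) := .inr hb
      have hc := hp.1.2 hb
      obtain ⟨e'', h4, h5, h6⟩ := edge_of_seg hs hcan h1 hbT h2
      refine ⟨e, b, .single h, hbT, .inr ⟨e'', ?_⟩⟩
      have hc' : Col e e'' := ⟨hc.1, h4.trans hc.2⟩
      rcases h3 with rfl | ⟨e2, f2, h7, h8⟩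
      · exact ⟨_, hc', .single h6⟩
      · exact ⟨f2, hc', .cons h6 ⟨h5.trans h7.1, h7.2⟩ h8⟩
    · refine ⟨f1, m, .cons h ⟨fun hc => hb (hp.1.1 hc), ?_⟩ h1, h2, h3⟩
      simp only [Set.mem_union, Set.mem_insert_iff, Set.mem_singleton_iff]
      tauto

theorem of_marg {G : MixedGraph V} (hs : G.BiSymm) {j k : V} {L : Set V} {e a f c}
    (h : W (EE (G.marg ({j, k} ∪ L))) (fun e v e' => Col e e' ∧ v ≠ k ∧ v ≠ j) e a f c) :
    ∃ e1 f1, arrowAtStart e1 = arrowAtStart e ∧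
      W (EE G) (fun e v e' => (Col e e' ↔ v ∈ L)) e1 a f1 c := by
  have hPN : ∀ e v e', PN ({j, k} ∪ L) e v e' → (Col e e' ↔ v ∈ L) := by
    rintro e v e' ⟨h1, h2⟩
    exact ⟨fun h => absurd h h1, fun h => absurd (.inr h) h2⟩
  induction h with
  | single h =>
    obtain ⟨e', f', h1, h2, h3, -⟩ := seg_of_edge hs h
    exact ⟨e', f', h1, h3.mono hPN⟩
  | @cons e a b e' f c h hp _ ih =>
    obtain ⟨e1, f1, h4, h5⟩ := ih
    obtain ⟨e', f', h1, h2, h3, -, hb⟩ := seg_of_edge hs h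
    refine ⟨e', f1, h1, (h3.mono hPN).append ?_ h5⟩
    have hbL : b ∈ L := by
      simp only [Set.mem_union, Set.mem_insert_iff, Set.mem_singleton_iff] at hb
      tauto
    exact ⟨fun _ => hbL, fun _ => ⟨h2.trans hp.1.1, h4.trans hp.1.2⟩⟩

end MWalk

/-- m-connection given `L` is equivalent to collider-connection in the marginal
graph on `{j, k} ∪ L`. -/
theorem mconn_iff_colliderconn_marg {V : Type*} (G : MixedGraph V) (hsymm : G.BiSymm)
    (hcan : G.Canonical) (j k : V) (L : Set V)
    (hjk : j ≠ k) (hjL : j ∉ L) (hkL : k ∉ L) :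
    G.MConn j k L ↔
      ∃ w : MWalk V, MWalk.IsWalkFrom (G.marg ({j, k} ∪ L)) w j k ∧
        w.IsColliderConnected := by
  simp only [MixedGraph.MConn, MWalk.not_blocked_iff, MWalk.cc_iff, MWalk.W_iff]
  have hj : j ∈ ({j, k} ∪ L : Set V) := by simp
  have hk : k ∈ ({j, k} ∪ L : Set V) := by simp
  constructor
  · rintro ⟨e, f, h⟩
    obtain ⟨e, f, h⟩ := h.cut
    obtain ⟨f1, m, h1, h2, h3⟩ := MWalk.to_marg hsymm hcan h hk
    obtain ⟨e'', h4, h5, h6⟩ := MWalk.edge_of_seg hsymm hcan h1 hj h2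
    rcases h3 with rfl | ⟨e2, f2, h7, h8⟩
    · exact ⟨_, _, .single h6⟩
    · exact ⟨e'', f2, .cons h6 ⟨h5.trans h7.1, h7.2⟩ h8⟩
  · rintro ⟨e, f, h⟩
    obtain ⟨e, f, h⟩ := h.cut
    obtain ⟨e1, f1, -, h1⟩ := MWalk.of_marg hsymm h
    exact ⟨e1, f1, h1⟩
end

section
/- Let G be a directed mixed graph on V = {1, …, d}, and let β, Λ ∈ ℝ^{d×d} be compatible with G, with Λ symmetric positive semi-definite and I − β invertible, and set Σ = (I − β)^{-T} Λ (I − β)^{-1}. If there is no trek from j to k in G, then Σ_{jk} = 0. -/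
theorem aux_inv (d : ℕ) (G : MixedGraph (Fin d)) (β : Matrix (Fin d) (Fin d) ℝ)
    (hβc : ∀ a b, β a b ≠ 0 → G.dir a b) (hinv : IsUnit (1 - β)) (a j : Fin d)
    (h : (1 - β)⁻¹ a j ≠ 0) : Relation.ReflTransGen G.dir a j := by
  classical
  by_contra hn
  apply h
  let f : Fin d → ℕ := fun x => if Relation.ReflTransGen G.dir x j then 0 else 1
  have hbt : Matrix.BlockTriangular (1 - β) f := by
    intro x y hxy
    by_cases hx : Relation.ReflTransGen G.dir x j
    · simp [f, hx] at hxy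
    by_cases hy : Relation.ReflTransGen G.dir y j
    · have hne : x ≠ y := by rintro rfl; exact hx hy
      have hb : β x y = 0 := by
        by_contra hb
        exact hx (Relation.ReflTransGen.head (hβc _ _ hb) hy)
      simp [Matrix.one_apply_ne hne, hb]
    · simp [f, hx, hy] at hxy
  haveI := hinv.invertible
  have := Matrix.blockTriangular_inv_of_blockTriangular hbt
  apply this
  simp [f, hn, Relation.ReflTransGen.refl]

theorem aux_right {V : Type*} (G : MixedGraph V) (b k : V)
    (h : Relation.ReflTransGen G.dir b k) :
    ∃ r : List (EKind × V), (∀ s ∈ r, s.1 = EKind.fwd) ∧ MWalk.Valid G b r ∧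
      (r.map Prod.snd).getLastD b = k := by
  induction h using Relation.ReflTransGen.head_induction_on with
  | refl => exact ⟨[], by simp, trivial, rfl⟩
  | head h1 hh ih =>
    rename_i a c
    obtain ⟨r, h2, h3, h4⟩ := ih
    refine ⟨(EKind.fwd, c) :: r, ?_, ⟨h1, h3⟩, ?_⟩
    · intro s hs
      rcases List.mem_cons.1 hs with rfl | hs
      · rfl
      · exact h2 s hs
    · rw [List.map_cons, List.getLastD_cons]; exact h4

theorem aux_left {V : Type*} (G : MixedGraph V) (a j k b : V) (r : List (EKind × V))
    (hab : G.bi a b) (hr : ∀ s ∈ r, s.1 = EKind.fwd) (hv : MWalk.Valid G b r)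
    (hk : (r.map Prod.snd).getLastD b = k)
    (h : Relation.ReflTransGen G.dir a j) :
    ∃ l : List (EKind × V), (∀ s ∈ l, s.1 = EKind.bwd) ∧
      MWalk.Valid G j (l ++ (EKind.bidir, b) :: r) ∧
      ((l ++ (EKind.bidir, b) :: r).map Prod.snd).getLastD j = k := by
  induction h with
  | refl =>
    refine ⟨[], by simp, ⟨hab, hv⟩, ?_⟩
    rw [List.nil_append, List.map_cons, List.getLastD_cons]; exact hk
  | tail hh h1 ih =>
    rename_i c e
    obtain ⟨l, h2, h3, h4⟩ := ih
    refine ⟨(EKind.bwd, c) :: l, ?_, ⟨h1, h3⟩, ?_⟩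
    · intro s hs
      rcases List.mem_cons.1 hs with rfl | hs
      · rfl
      · exact h2 s hs
    · rw [List.cons_append, List.map_cons, List.getLastD_cons]; exact h4

open Matrix in
/-- If there is no trek from `j` to `k`, then the `(j,k)` entry of the
covariance matrix `Σ = (I - β)⁻ᵀ Λ (I - β)⁻¹` of the Gaussian linear system
vanishes. -/
theorem no_trek_zero_covariance (d : ℕ) (G : MixedGraph (Fin d)) (hsymm : G.BiSymm)
    (β Λ : Matrix (Fin d) (Fin d) ℝ)
    (hβc : ∀ a b, β a b ≠ 0 → G.dir a b) (hΛc : ∀ a b, Λ a b ≠ 0 → G.bi a b)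
    (hΛsym : Λ.IsSymm) (hpsd : Λ.PosSemidef) (hinv : IsUnit (1 - β))
    (j k : Fin d)
    (hnotrek : ¬ ∃ w : MWalk (Fin d), MWalk.IsWalkFrom G w j k ∧ w.IsTrek) :
    ∀ Sm : Matrix (Fin d) (Fin d) ℝ, Sm = ((1 - β)⁻¹)ᵀ * Λ * (1 - β)⁻¹ →
      Sm j k = 0 := by
  rintro Sm rfl
  by_contra hne
  rw [Matrix.mul_apply] at hne
  obtain ⟨b, -, hb⟩ := Finset.exists_ne_zero_of_sum_ne_zero hne
  have hb1 := left_ne_zero_of_mul hb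
  have hb2 := right_ne_zero_of_mul hb
  rw [Matrix.mul_apply] at hb1
  obtain ⟨a, -, ha⟩ := Finset.exists_ne_zero_of_sum_ne_zero hb1
  have ha1 := left_ne_zero_of_mul ha
  have ha2 := right_ne_zero_of_mul ha
  rw [Matrix.transpose_apply] at ha1
  obtain ⟨r, hr, hv, hk⟩ := aux_right G b k (aux_inv d G β hβc hinv b k hb2)
  obtain ⟨l, hl, hv', hk'⟩ := aux_left G a j k b r (hΛc _ _ ha2) hr hv hk
    (aux_inv d G β hβc hinv a j ha1)
  exact hnotrek ⟨⟨j, l ++ (EKind.bidir, b) :: r⟩, ⟨⟨by simp, hv'⟩, rfl, hk'⟩,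
    l, (EKind.bidir, b), r, rfl, hl, rfl, hr⟩
end
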